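/- arXiv:2303.11789 — 2 statements merged into one kernel-verified Lean document; each statement's English description precedes it below -/
import Mathlib

section
/- Consider the randomly time-varying difference equation x(k+1) = (I − F(k)) x(k) + G(k) u(k), k ≥ 0, with deterministic initial value x(0) ∈ X₁, and let 𝓕(k) be the σ-algebra generated by all maps ω ↦ F(s)(ω)x (x ∈ X₁), all maps ω ↦ G(s)(ω)y (y ∈ X₂), and all u(s) for 0 ≤ s ≤ k, with 𝓕(−1) = {∅, Ω}. Suppose: {u(k), 𝓕(k)} is a martingale difference sequence with sup_k E[‖u(k)‖²] < ∞; the family {u(k), k ≥ 0} is independent of the family {F(k), G(k), k ≥ 0}; (i) the sequence {I − F(k), k ≥ 0} is L₂²-stable with respect to {𝓕(k)}; (ii) there are nonnegative reals γ(k) with ∑_k γ(k) < ∞ such that E[‖I − F(k)‖⁴ | 𝓕(k−1)] ≤ 1 + γ(k) a.s. for every k; and (iii) ∑_k E[‖G(k)‖²] < ∞ and sup_k E[‖G(k)‖⁴] < ∞. Then the solution sequence is L₂-asymptotically stable: lim_{k→∞} E[‖x(k)‖²] = 0. -/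
open MeasureTheory ProbabilityTheory Filter ENNReal

noncomputable section

/-- The ordered product `A(m) ∘ A(m−1) ∘ ⋯ ∘ A(n+1)` (the identity when `m ≤ n`). -/
def opProdIoc {E : Type*} [NormedAddCommGroup E] [NormedSpace ℝ E]
    (A : ℕ → E →L[ℝ] E) (n m : ℕ) : E →L[ℝ] E :=
  (((List.range' (n + 1) (m - n)).reverse).map A).prod

/-- `L₂²`-stability of a sequence of operator-valued random elements `A(k)` with respect to a
filtration `G(k)`: for every `L₂`-bounded adapted sequence `x(k)`,
`E[‖A(m)⋯A(n+1) x(n)‖²] → 0` as `m → ∞`, for every `n`. -/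
def L2SqStable {Ω : Type*} [MeasurableSpace Ω] (P : Measure Ω)
    {E : Type*} [NormedAddCommGroup E] [NormedSpace ℝ E]
    (A : ℕ → Ω → (E →L[ℝ] E)) (G : ℕ → MeasurableSpace Ω) : Prop :=
  ∀ x : ℕ → Ω → E,
    (∀ k, StronglyMeasurable[G k] (x k)) →
    (⨆ k, ∫⁻ ω, (‖x k ω‖₊ : ℝ≥0∞) ^ 2 ∂P) < ⊤ →
    ∀ n : ℕ, Tendsto (fun m => ∫⁻ ω, (‖opProdIoc (fun j => A j ω) n m (x n ω)‖₊ : ℝ≥0∞) ^ 2 ∂P)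
      atTop (nhds 0)

/-- The σ-algebra `𝓕(k−1)` generated by the maps `ω ↦ F(s)(ω)x`, `ω ↦ G(s)(ω)y` and the noises
`u(s)` for `0 ≤ s ≤ k−1` (so `filtFGu 0` is the trivial σ-algebra `𝓕(−1)`). -/
def filtFGu {Ω X₁ X₂ : Type*} [MeasurableSpace Ω]
    [NormedAddCommGroup X₁] [NormedSpace ℝ X₁] [NormedAddCommGroup X₂] [NormedSpace ℝ X₂]
    (F : ℕ → Ω → (X₁ →L[ℝ] X₁)) (G : ℕ → Ω → (X₂ →L[ℝ] X₁)) (u : ℕ → Ω → X₂)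
    (k : ℕ) : MeasurableSpace Ω :=
  ⨆ s ∈ Finset.range k,
    ((⨆ x : X₁, MeasurableSpace.comap (fun ω => F s ω x) (borel X₁)) ⊔
      (⨆ y : X₂, MeasurableSpace.comap (fun ω => G s ω y) (borel X₁)) ⊔
      MeasurableSpace.comap (u s) (borel X₂))

section StrongOperatorMeasurability

variable {Ω E F : Type*} [NormedAddCommGroup E]

theorem stronglyMeasurable_of_comap_borel_le {m₀ m : MeasurableSpace Ω} {f : Ω → E}
    (hf : StronglyMeasurable[m₀] f) (h : MeasurableSpace.comap f (borel E) ≤ m) :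
    StronglyMeasurable[m] f := by
  borelize E
  exact stronglyMeasurable_iff_measurable_separable.2
    ⟨measurable_iff_comap_le.2 h, hf.isSeparable_range⟩

theorem comap_borel_le_of_stronglyMeasurable {m : MeasurableSpace Ω} {f : Ω → E}
    (hf : StronglyMeasurable[m] f) : MeasurableSpace.comap f (borel E) ≤ m := by
  borelize E
  exact hf.measurable.comap_le

variable [NormedSpace ℝ E] [NormedAddCommGroup F] [NormedSpace ℝ F]

/-- Evaluating a strong-operator measurable family at a strongly measurable vector. -/
theorem stronglyMeasurable_clm_apply_of_forall {m : MeasurableSpace Ω} {A : Ω → E →L[ℝ] F}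
    {y : Ω → E} (hA : ∀ v, StronglyMeasurable[m] fun ω => A ω v) (hy : StronglyMeasurable[m] y) :
    StronglyMeasurable[m] fun ω => A ω (y ω) := by
  refine stronglyMeasurable_of_tendsto (f := fun n ω => A ω (hy.approx n ω)) atTop (fun n => ?_)
    (tendsto_pi_nhds.2 fun ω => ((A ω).continuous.tendsto _).comp (hy.tendsto_approx ω))
  have h : (fun ω => A ω (hy.approx n ω)) = fun ω =>
      ∑ v ∈ (hy.approx n).range, ((hy.approx n) ⁻¹' {v}).indicator (fun ω => A ω v) ω := by
    ext ω
    rw [Finset.sum_eq_single_of_mem (hy.approx n ω) (SimpleFunc.mem_range_self _ _)]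
    · simp
    · intro b _ hb
      simp [Set.indicator, hb.symm]
  rw [h]
  exact Finset.stronglyMeasurable_fun_sum _ fun v _ =>
    (hA v).indicator ((hy.approx n).measurableSet_fiber v)

/-- The operator norm of a strong-operator measurable family need not be measurable, but along a
given strongly measurable vector it may be replaced by a measurable minorant. -/
theorem exists_measurable_enorm_clm_apply_le {m m₀ : MeasurableSpace Ω} {A : Ω → E →L[ℝ] F}
    {y : Ω → E} (hA : ∀ v, StronglyMeasurable[m] fun ω => A ω v)
    (hy : StronglyMeasurable[m₀] y) :
    ∃ c : Ω → ℝ≥0∞, Measurable[m] c ∧ (∀ ω, c ω ≤ ‖A ω‖ₑ) ∧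
      ∀ ω, ‖A ω (y ω)‖ₑ ≤ c ω * ‖y ω‖ₑ := by
  obtain ⟨D, hD, hyD⟩ := hy.isSeparable_range
  have : Countable D := hD
  have hle : ∀ ω, (⨆ v : D, ‖A ω v‖ₑ / ‖(v : E)‖ₑ) ≤ ‖A ω‖ₑ := fun ω =>
    iSup_le fun v => ENNReal.div_le_of_le_mul ((A ω).le_opENorm v)
  refine ⟨fun ω => ⨆ v : D, ‖A ω v‖ₑ / ‖(v : E)‖ₑ, ?_, hle, fun ω => ?_⟩
  · exact Measurable.iSup fun v => (hA v).enorm.div_const _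
  · set c := ⨆ v : D, ‖A ω v‖ₑ / ‖(v : E)‖ₑ
    have hctop : c ≠ ⊤ := ((hle ω).trans_lt enorm_lt_top).ne
    have hcl : IsClosed {v : E | ‖A ω v‖ₑ ≤ c * ‖v‖ₑ} :=
      isClosed_le (A ω).continuous.enorm
        ((ENNReal.continuous_const_mul hctop).comp continuous_enorm)
    refine closure_minimal (fun v hv => ?_) hcl (hyD ⟨ω, rfl⟩)
    by_cases h0 : v = 0
    · simp [h0]
    · have := le_iSup (fun v : D => ‖A ω v‖ₑ / ‖(v : E)‖ₑ) ⟨v, hv⟩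
      exact (ENNReal.div_le_iff (by simpa using h0) enorm_ne_top).1 this

theorem opProdIoc_self (A : ℕ → E →L[ℝ] E) (n : ℕ) : opProdIoc A n n = 1 := by
  simp [opProdIoc]

theorem opProdIoc_of_le (A : ℕ → E →L[ℝ] E) {n m : ℕ} (h : m ≤ n) : opProdIoc A n m = 1 := by
  simp [opProdIoc, Nat.sub_eq_zero_of_le h]

theorem opProdIoc_succ (A : ℕ → E →L[ℝ] E) {n m : ℕ} (h : n ≤ m) :
    opProdIoc A n (m + 1) = A (m + 1) * opProdIoc A n m := by
  rw [opProdIoc, opProdIoc, Nat.sub_add_comm h, List.range'_concat]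
  simp [show n + 1 + (m - n) = m + 1 by omega]

theorem stronglyMeasurable_opProdIoc_apply {m : MeasurableSpace Ω} {A : ℕ → Ω → E →L[ℝ] E}
    {y : Ω → E} {n k : ℕ}
    (hA : ∀ j ∈ Finset.Ioc n k, ∀ v, StronglyMeasurable[m] fun ω => A j ω v)
    (hy : StronglyMeasurable[m] y) :
    StronglyMeasurable[m] fun ω => opProdIoc (fun j => A j ω) n k (y ω) := by
  induction k with
  | zero => simpa [opProdIoc_of_le] using hy
  | succ k ih =>
    rcases Nat.lt_or_ge k n with h | h
    · simpa [opProdIoc_of_le _ h] using hy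
    · simp only [opProdIoc_succ _ h, mul_apply_eq_comp]
      refine stronglyMeasurable_clm_apply_of_forall (hA (k + 1) (by simp; omega)) (ih ?_)
      exact fun j hj => hA j (by simp at hj ⊢; omega)

end StrongOperatorMeasurability

section ConditionalExpectation

variable {Ω : Type*} {m₀ : MeasurableSpace Ω} {P : Measure Ω}

theorem lintegral_mul_ofReal_le_of_condExp_le [IsFiniteMeasure P] {m : MeasurableSpace Ω}
    (hm : m ≤ m₀) {Z : Ω → ℝ} (hZ : Integrable Z P) (hZ0 : ∀ ω, 0 ≤ Z ω) {c : ℝ} (hc : 0 ≤ c)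
    (hZc : P[Z | m] ≤ᵐ[P] fun _ => c) {Y : Ω → ℝ≥0∞} (hY : Measurable[m] Y) :
    ∫⁻ ω, Y ω * ENNReal.ofReal (Z ω) ∂P ≤ ENNReal.ofReal c * ∫⁻ ω, Y ω ∂P := by
  have hle : (P.withDensity fun ω => ENNReal.ofReal (Z ω)).trim hm
      ≤ (ENNReal.ofReal c • P).trim hm := by
    refine Measure.le_iff.2 fun s hs => ?_
    rw [trim_measurableSet_eq hm hs, trim_measurableSet_eq hm hs, withDensity_apply _ (hm s hs),
      ← ofReal_integral_eq_lintegral_ofReal hZ.restrict (ae_of_all _ hZ0),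
      ← setIntegral_condExp hm hZ hs, Measure.smul_apply, smul_eq_mul,
      ← ofReal_measureReal, ← ENNReal.ofReal_mul hc]
    refine ENNReal.ofReal_le_ofReal ((setIntegral_mono_ae integrable_condExp.integrableOn
      (integrable_const c).integrableOn hZc).trans ?_)
    simp [mul_comm]
  calc ∫⁻ ω, Y ω * ENNReal.ofReal (Z ω) ∂P
      = ∫⁻ ω, Y ω ∂(P.withDensity fun ω => ENNReal.ofReal (Z ω)) := by
        rw [lintegral_withDensity_eq_lintegral_mul₀ hZ.aemeasurable.ennreal_ofReal
          (hY.mono hm le_rfl).aemeasurable]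
        simp [mul_comm]
    _ ≤ ∫⁻ ω, Y ω ∂(ENNReal.ofReal c • P) := by
        rw [← lintegral_trim hm hY, ← lintegral_trim hm hY]
        exact lintegral_mono' hle le_rfl
    _ = _ := by rw [lintegral_smul_measure, smul_eq_mul]

/-- Enlarging the conditioning by an independent σ-algebra preserves a vanishing conditional
expectation. -/
theorem condExp_sup_eq_zero_of_indep [IsFiniteMeasure P] {E : Type*} [NormedAddCommGroup E]
    [NormedSpace ℝ E] [CompleteSpace E] {m₁ m₂ mU : MeasurableSpace Ω} (hm₁ : m₁ ≤ m₀)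
    (hm₂ : m₂ ≤ mU) (hmU : mU ≤ m₀) (hind : Indep mU m₁ P) {f : Ω → E}
    (hf : StronglyMeasurable[mU] f) (hfi : Integrable f P)
    (hf0 : ∀ s, MeasurableSet[m₂] s → ∫ ω in s, f ω ∂P = 0) :
    P[f | m₁ ⊔ m₂] =ᵐ[P] 0 := by
  have hsup : m₁ ⊔ m₂ ≤ m₀ := sup_le hm₁ (hm₂.trans hmU)
  have hgen : m₁ ⊔ m₂ = MeasurableSpace.generateFrom
      (Set.image2 (· ∩ ·) {s | MeasurableSet[m₁] s} {s | MeasurableSet[m₂] s}) := by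
    apply le_antisymm
    · refine sup_le (fun s hs => ?_) (fun s hs => ?_)
      · exact MeasurableSpace.measurableSet_generateFrom
          ⟨s, hs, Set.univ, @MeasurableSet.univ _ m₂, Set.inter_univ s⟩
      · exact MeasurableSpace.measurableSet_generateFrom
          ⟨Set.univ, @MeasurableSet.univ _ m₁, s, hs, Set.univ_inter s⟩
    · refine MeasurableSpace.generateFrom_le ?_
      rintro _ ⟨s, hs, t, ht, rfl⟩
      exact @MeasurableSet.inter _ (m₁ ⊔ m₂) s t ((le_sup_left : m₁ ≤ m₁ ⊔ m₂) s hs)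
        ((le_sup_right : m₂ ≤ m₁ ⊔ m₂) t ht)
  have hpi : IsPiSystem
      (Set.image2 (· ∩ ·) {s | MeasurableSet[m₁] s} {s | MeasurableSet[m₂] s}) := by
    rintro _ ⟨s, hs, t, ht, rfl⟩ _ ⟨s', hs', t', ht', rfl⟩ -
    exact ⟨s ∩ s', @MeasurableSet.inter _ m₁ _ _ hs hs', t ∩ t',
      @MeasurableSet.inter _ m₂ _ _ ht ht', Set.inter_inter_inter_comm _ _ _ _⟩
  have hbase : ∀ s, MeasurableSet[m₁] s → ∀ t, MeasurableSet[m₂] t →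
      ∫ ω in s ∩ t, f ω ∂P = 0 := by
    intro s hs t ht
    have ht₀ := hmU t (hm₂ t ht)
    have h := condExp_indep_eq hmU hm₁ (hf.indicator (hm₂ t ht)) hind
    rw [integral_indicator ht₀, hf0 t ht] at h
    rw [← setIntegral_indicator ht₀,
      ← setIntegral_condExp hm₁ (hfi.indicator ht₀) hs,
      setIntegral_congr_ae (g := fun _ => 0) (hm₁ s hs) (h.mono fun ω hω _ => hω)]
    simp
  have hall : ∀ s, MeasurableSet[m₁ ⊔ m₂] s → ∫ ω in s, f ω ∂P = 0 := by
    intro s hs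
    induction s, hs using MeasurableSpace.induction_on_inter hgen hpi with
    | empty => simp
    | basic s hs =>
      obtain ⟨s, hs, t, ht, rfl⟩ := hs
      exact hbase s hs t ht
    | compl s hs ih =>
      have h := hbase Set.univ (@MeasurableSet.univ _ m₁) Set.univ (@MeasurableSet.univ _ m₂)
      rw [Set.inter_univ, setIntegral_univ, ← integral_add_compl (hsup s hs) hfi, ih,
        zero_add] at h
      exact h
    | iUnion s hd hs ih =>
      rw [integral_iUnion (fun i => hsup _ (hs i)) hd hfi.integrableOn]
      simp [ih]
  symm
  refine ae_eq_condExp_of_forall_setIntegral_eq hsup hfi (fun s _ _ => integrableOn_zero)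
    (fun s hs _ => ?_) aestronglyMeasurable_zero
  simp [hall s hs]

open scoped InnerProductSpace in
/-- A weakly measurable family of functionals is represented, along a strongly measurable
vector, by a strongly measurable vector. -/
theorem exists_stronglyMeasurable_inner_eq {E : Type*} [NormedAddCommGroup E]
    [InnerProductSpace ℝ E] [CompleteSpace E] {m : MeasurableSpace Ω} {ℓ : Ω → E →L[ℝ] ℝ}
    (hℓ : ∀ v, StronglyMeasurable[m] fun ω => ℓ ω v) {f : Ω → E} (hf : StronglyMeasurable[m₀] f) :
    ∃ w : Ω → E, StronglyMeasurable[m] w ∧ ∀ ω, ⟪w ω, f ω⟫_ℝ = ℓ ω (f ω) := by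
  obtain ⟨D, hD, hfD⟩ := hf.isSeparable_range
  obtain ⟨d, hd⟩ : ∃ d : ℕ → E, D ⊆ Set.range d := by
    obtain ⟨d, hd⟩ := (hD.insert 0).exists_eq_range (Set.insert_nonempty 0 D)
    exact ⟨d, hd ▸ Set.subset_insert _ _⟩
  let V : ℕ → Submodule ℝ E := fun n => Submodule.span ℝ (d '' Set.Iio n)
  have hVmono : Monotone V := fun a b hab =>
    Submodule.span_mono (Set.image_mono (Set.Iio_subset_Iio hab))
  have hfin : ∀ n, FiniteDimensional ℝ (V n) := fun n =>
    FiniteDimensional.span_of_finite ℝ ((Set.finite_Iio n).image d)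
  let S : Submodule ℝ E := (⨆ n, V n).topologicalClosure
  have hfS : ∀ ω, f ω ∈ S := by
    intro ω
    refine closure_mono ?_ (hfD ⟨ω, rfl⟩)
    intro v hv
    obtain ⟨n, rfl⟩ := hd hv
    exact Submodule.mem_iSup_of_mem (n + 1) (Submodule.subset_span ⟨n, by simp, rfl⟩)
  let r : Ω → E := fun ω => (InnerProductSpace.toDual ℝ E).symm (ℓ ω)
  have hr : ∀ ω v, ⟪r ω, v⟫_ℝ = ℓ ω v := fun ω v => by
    simp [r, InnerProductSpace.toDual_symm_apply]
  refine ⟨fun ω => S.starProjection (r ω), ?_, fun ω => ?_⟩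
  · refine stronglyMeasurable_of_tendsto (f := fun n ω => (V n).starProjection (r ω)) atTop
      (fun n => ?_) (tendsto_pi_nhds.2 fun ω =>
        Submodule.starProjection_tendsto_closure_iSup V hVmono (r ω))
    have h : (fun ω => (V n).starProjection (r ω)) = fun ω =>
        ∑ i, ℓ ω (stdOrthonormalBasis ℝ (V n) i : E) • (stdOrthonormalBasis ℝ (V n) i : E) := by
      ext ω
      rw [Submodule.starProjection_apply,
        (stdOrthonormalBasis ℝ (V n)).orthogonalProjectionOnto_apply_eq_sum]
      simp [← hr, real_inner_comm]
    rw [h]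
    exact Finset.stronglyMeasurable_fun_sum _ fun i _ => (hℓ _).smul_const _
  · rw [Submodule.inner_starProjection_left_eq_right, Submodule.starProjection_eq_self_iff.2 (hfS ω),
      hr]

open scoped InnerProductSpace in
/-- The second moments of a vector `s` and of a martingale increment `B f` add up. -/
theorem lintegral_enorm_add_clm_apply_sq_of_condExp_eq_zero [IsFiniteMeasure P] {E E' : Type*}
    [NormedAddCommGroup E] [InnerProductSpace ℝ E] [CompleteSpace E]
    [NormedAddCommGroup E'] [InnerProductSpace ℝ E'] {m : MeasurableSpace Ω} (hm : m ≤ m₀)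
    {s : Ω → E'} (hs : StronglyMeasurable[m] s) {B : Ω → E →L[ℝ] E'}
    (hB : ∀ v, StronglyMeasurable[m] fun ω => B ω v) {f : Ω → E} (hf : StronglyMeasurable[m₀] f)
    (hfi : Integrable f P) (hf0 : P[f | m] =ᵐ[P] 0) (hs2 : ∫⁻ ω, ‖s ω‖ₑ ^ 2 ∂P ≠ ⊤)
    (hB2 : ∫⁻ ω, ‖B ω (f ω)‖ₑ ^ 2 ∂P ≠ ⊤) :
    ∫⁻ ω, ‖s ω + B ω (f ω)‖ₑ ^ 2 ∂P = ∫⁻ ω, ‖s ω‖ₑ ^ 2 ∂P + ∫⁻ ω, ‖B ω (f ω)‖ₑ ^ 2 ∂P := by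
  have hBf : StronglyMeasurable[m₀] fun ω => B ω (f ω) :=
    stronglyMeasurable_clm_apply_of_forall (fun v => (hB v).mono hm) hf
  have memLp : ∀ g : Ω → E', StronglyMeasurable[m₀] g → ∫⁻ ω, ‖g ω‖ₑ ^ 2 ∂P ≠ ⊤ →
      MemLp g 2 P := fun g hg hg2 => by
    refine ⟨hg.aestronglyMeasurable, ?_⟩
    rw [eLpNorm_lt_top_iff_lintegral_rpow_enorm_lt_top (by simp) (by simp)]
    simpa using hg2.lt_top
  have toInt : ∀ g : Ω → E', MemLp g 2 P →
      ∫⁻ ω, ‖g ω‖ₑ ^ 2 ∂P = ENNReal.ofReal (∫ ω, ‖g ω‖ ^ 2 ∂P) := fun g hg => by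
    rw [ofReal_integral_eq_lintegral_ofReal (hg.integrable_norm_pow (by simp))
      (ae_of_all _ fun ω => by positivity)]
    simp [ENNReal.ofReal_pow]
  have hsL := memLp s (hs.mono hm) hs2
  have hBL := memLp _ hBf hB2
  have hin : Integrable (fun ω => ⟪s ω, B ω (f ω)⟫_ℝ) P := by
    refine ((hsL.integrable_norm_pow (p := 2) (by simp)).add
      (hBL.integrable_norm_pow (p := 2) (by simp))).mono'
      ((hs.mono hm).inner hBf).aestronglyMeasurable (ae_of_all _ fun ω => ?_)
    refine (norm_inner_le_norm (𝕜 := ℝ) (s ω) (B ω (f ω))).trans ?_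
    simp only [Pi.add_apply]
    nlinarith [sq_nonneg (‖s ω‖ - ‖B ω (f ω)‖), sq_nonneg (‖s ω‖ + ‖B ω (f ω)‖)]
  obtain ⟨w, hw, hwf⟩ := exists_stronglyMeasurable_inner_eq (m := m)
    (ℓ := fun ω => (innerSL ℝ (s ω)).comp (B ω))
    (fun v => by simpa using hs.inner (hB v)) hf
  simp only [ContinuousLinearMap.comp_apply, innerSL_apply_apply] at hwf
  have hcross : ∫ ω, ⟪s ω, B ω (f ω)⟫_ℝ ∂P = 0 := by
    simp only [← hwf] at hin ⊢
    have h := condExp_bilin_of_stronglyMeasurable_left (innerSL ℝ) hw hin hfi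
    rw [← integral_condExp hm]
    refine integral_eq_zero_of_ae (h.trans ?_)
    filter_upwards [hf0] with ω hω
    simp [hω]
  have hadd := toInt _ (hsL.add hBL)
  simp only [Pi.add_apply] at hadd
  rw [hadd, toInt _ hsL, toInt _ hBL, ← ENNReal.ofReal_add
    (integral_nonneg fun ω => by positivity) (integral_nonneg fun ω => by positivity)]
  congr 1
  have h1 := hsL.integrable_norm_pow (p := 2) (by simp)
  have h2 := hBL.integrable_norm_pow (p := 2) (by simp)
  simp only [norm_add_sq_real]
  have h12 : Integrable (fun ω => ‖s ω‖ ^ 2 + 2 * ⟪s ω, B ω (f ω)⟫_ℝ) P :=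
    h1.add (hin.const_mul 2)
  rw [integral_add h12 h2, integral_add h1 (hin.const_mul 2),
    integral_const_mul, hcross]
  simp

end ConditionalExpectation

section RandomDifferenceEquation

variable {Ω X₁ X₂ : Type*} {m₀ : MeasurableSpace Ω} {P : Measure Ω}
  [NormedAddCommGroup X₁] [NormedSpace ℝ X₁] [NormedAddCommGroup X₂] [NormedSpace ℝ X₂]
  {F : ℕ → Ω → (X₁ →L[ℝ] X₁)} {G : ℕ → Ω → (X₂ →L[ℝ] X₁)} {u : ℕ → Ω → X₂}

theorem filtFGu_le (hF : ∀ k x, StronglyMeasurable (fun ω => F k ω x))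
    (hG : ∀ k y, StronglyMeasurable (fun ω => G k ω y)) (hu : ∀ k, StronglyMeasurable (u k))
    (k : ℕ) : filtFGu F G u k ≤ m₀ :=
  iSup₂_le fun s _ => sup_le (sup_le
    (iSup_le fun x => comap_borel_le_of_stronglyMeasurable (hF s x))
    (iSup_le fun y => comap_borel_le_of_stronglyMeasurable (hG s y)))
    (comap_borel_le_of_stronglyMeasurable (hu s))

theorem stronglyMeasurable_filtFGu_left (hF : ∀ k x, StronglyMeasurable (fun ω => F k ω x))
    {s k : ℕ} (h : s < k) (x : X₁) :
    StronglyMeasurable[filtFGu F G u k] fun ω => F s ω x := by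
  refine stronglyMeasurable_of_comap_borel_le (hF s x) ?_
  refine le_trans ?_ (le_iSup₂_of_le s (Finset.mem_range.2 h) le_rfl)
  exact le_sup_of_le_left (le_sup_of_le_left
    (le_iSup (fun x => MeasurableSpace.comap (fun ω => F s ω x) (borel X₁)) x))

theorem stronglyMeasurable_filtFGu_mid (hG : ∀ k y, StronglyMeasurable (fun ω => G k ω y))
    {s k : ℕ} (h : s < k) (y : X₂) :
    StronglyMeasurable[filtFGu F G u k] fun ω => G s ω y := by
  refine stronglyMeasurable_of_comap_borel_le (hG s y) ?_
  refine le_trans ?_ (le_iSup₂_of_le s (Finset.mem_range.2 h) le_rfl)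
  exact le_sup_of_le_left (le_sup_of_le_right
    (le_iSup (fun y => MeasurableSpace.comap (fun ω => G s ω y) (borel X₁)) y))

theorem comap_le_filtFGu {s k : ℕ} (h : s < k) :
    MeasurableSpace.comap (u s) (borel X₂) ≤ filtFGu F G u k :=
  le_trans le_sup_right (le_iSup₂_of_le s (Finset.mem_range.2 h) le_rfl)

/-- The σ-algebra generated by all the operators `F(k)` and `G(k)`. -/
abbrev sigmaFG (F : ℕ → Ω → (X₁ →L[ℝ] X₁)) (G : ℕ → Ω → (X₂ →L[ℝ] X₁)) : MeasurableSpace Ω :=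
  ⨆ k, ((⨆ x : X₁, MeasurableSpace.comap (fun ω => F k ω x) (borel X₁)) ⊔
    (⨆ y : X₂, MeasurableSpace.comap (fun ω => G k ω y) (borel X₁)))

/-- The σ-algebra generated by all the noises `u(k)`. -/
abbrev sigmaNoise (u : ℕ → Ω → X₂) : MeasurableSpace Ω :=
  ⨆ k, MeasurableSpace.comap (u k) (borel X₂)

/-- The σ-algebra generated by the noises `u(s)`, `s < j`. -/
abbrev sigmaPastNoise (u : ℕ → Ω → X₂) (j : ℕ) : MeasurableSpace Ω :=
  ⨆ s ∈ Finset.range j, MeasurableSpace.comap (u s) (borel X₂)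

/-- One step of the homogeneous recursion expands the second moment by at most `1 + γ`. -/
theorem lintegral_enorm_clm_apply_sq_le_of_condExp_le [IsFiniteMeasure P] {m : MeasurableSpace Ω}
    (hm : m ≤ m₀) {T : Ω → (X₁ →L[ℝ] X₁)} {g : ℝ} (hg : 0 ≤ g)
    (hT : Integrable (fun ω => ‖T ω‖ ^ 4) P)
    (hTg : P[fun ω => ‖T ω‖ ^ 4 | m] ≤ᵐ[P] fun _ => 1 + g) {y : Ω → X₁}
    (hy : StronglyMeasurable[m] y) :
    ∫⁻ ω, ‖T ω (y ω)‖ₑ ^ 2 ∂P ≤ ENNReal.ofReal (1 + g) * ∫⁻ ω, ‖y ω‖ₑ ^ 2 ∂P := by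
  have hY : Measurable[m] fun ω => ‖y ω‖ₑ ^ 2 := hy.enorm.pow_const 2
  have h1 := lintegral_mul_ofReal_le_of_condExp_le hm hT (fun ω => pow_nonneg (norm_nonneg _) 4)
    (by positivity : (0 : ℝ) ≤ 1 + g) hTg hY
  have hpt : ∀ ω, 2 * ‖T ω (y ω)‖ₑ ^ 2
      ≤ ‖y ω‖ₑ ^ 2 + ‖y ω‖ₑ ^ 2 * ENNReal.ofReal (‖T ω‖ ^ 4) := by
    intro ω
    have hop : ‖T ω (y ω)‖ ^ 2 ≤ (‖T ω‖ * ‖y ω‖) ^ 2 := by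
      gcongr
      exact (T ω).le_opNorm _
    have hreal : 2 * ‖T ω (y ω)‖ ^ 2 ≤ ‖y ω‖ ^ 2 + ‖y ω‖ ^ 2 * ‖T ω‖ ^ 4 := by
      nlinarith [mul_nonneg (sq_nonneg ‖y ω‖) (sq_nonneg (‖T ω‖ ^ 2 - 1))]
    have := ENNReal.ofReal_le_ofReal hreal
    rw [ENNReal.ofReal_mul (by norm_num), ENNReal.ofReal_add (by positivity) (by positivity),
      ENNReal.ofReal_mul (by positivity), ENNReal.ofReal_pow (norm_nonneg _),
      ENNReal.ofReal_pow (norm_nonneg _)] at this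
    simpa using this
  have h2 : 2 * ∫⁻ ω, ‖T ω (y ω)‖ₑ ^ 2 ∂P
      ≤ 2 * (ENNReal.ofReal (1 + g) * ∫⁻ ω, ‖y ω‖ₑ ^ 2 ∂P) := by
    rw [← lintegral_const_mul' _ _ (by simp)]
    refine (lintegral_mono hpt).trans ?_
    rw [lintegral_add_left (hY.mono hm le_rfl), two_mul]
    gcongr
    exact le_mul_of_one_le_left' (by simpa using hg)
  exact (ENNReal.mul_le_mul_iff_right (by simp) (by simp)).1 h2

end RandomDifferenceEquation

theorem ENNReal.tendsto_tsum_nhds_zero_of_dominated {e : ℕ → ℕ → ℝ≥0∞} {b : ℕ → ℝ≥0∞}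
    (hb : ∑' i, b i ≠ ⊤) (hle : ∀ i n, e i n ≤ b i)
    (hlim : ∀ i, Tendsto (e i) atTop (nhds 0)) :
    Tendsto (fun n => ∑' i, e i n) atTop (nhds 0) := by
  have h := tendsto_lintegral_of_dominated_convergence (μ := Measure.count)
    (F := fun n i => e i n) (f := fun _ => 0) b (fun n => measurable_of_countable _)
    (fun n => ae_of_all _ fun i => hle i n) (by rwa [lintegral_count])
    (ae_of_all _ fun i => hlim i)
  simpa [lintegral_count] using h

/-- Lemma 1. For the randomly time-varying difference equation
`x(k+1) = (I − F(k))x(k) + G(k)u(k)` in a Hilbert space, if `{u(k), 𝓕(k)}` is an `L₂`-bounded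
martingale difference sequence independent of `{F(k), G(k)}`, `{I − F(k)}` is `L₂²`-stable with
respect to `{𝓕(k)}`, `E[‖I − F(k)‖⁴ | 𝓕(k−1)] ≤ 1 + γ(k)` a.s. with `∑ γ(k) < ∞`, and
`∑ E[‖G(k)‖²] < ∞`, `sup_k E[‖G(k)‖⁴] < ∞`, then `E[‖x(k)‖²] → 0`. -/
theorem decentralized_online_learning.stmt0
    {Ω : Type*} [MeasurableSpace Ω] (P : Measure Ω) [IsProbabilityMeasure P]
    {X₁ : Type*} [NormedAddCommGroup X₁] [InnerProductSpace ℝ X₁] [CompleteSpace X₁]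
    {X₂ : Type*} [NormedAddCommGroup X₂] [InnerProductSpace ℝ X₂] [CompleteSpace X₂]
    (F : ℕ → Ω → (X₁ →L[ℝ] X₁)) (G : ℕ → Ω → (X₂ →L[ℝ] X₁)) (u : ℕ → Ω → X₂)
    -- random elements (with respect to the strong operator topology for `F`, `G`)
    (hF_meas : ∀ k (x : X₁), StronglyMeasurable (fun ω => F k ω x))
    (hG_meas : ∀ k (y : X₂), StronglyMeasurable (fun ω => G k ω y))
    (hu_meas : ∀ k, StronglyMeasurable (u k))
    -- the solution of the difference equation with deterministic initial value
    (x : ℕ → Ω → X₁)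
    (hx_init : ∃ c : X₁, ∀ ω, x 0 ω = c)
    (hx_rec : ∀ k ω, x (k + 1) ω
        = ((1 : X₁ →L[ℝ] X₁) - F k ω) (x k ω) + G k ω (u k ω))
    -- `{u(k), 𝓕(k)}` is an `L₂`-bounded martingale difference sequence
    (hu_int : ∀ k, Integrable (u k) P)
    (hu_mds : ∀ k, P[u k | filtFGu F G u k] =ᵐ[P] 0)
    (hu_bdd : (⨆ k, ∫⁻ ω, (‖u k ω‖₊ : ℝ≥0∞) ^ 2 ∂P) < ⊤)
    -- `{u(k)}` is independent of `{F(k), G(k)}`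
    (hindep : Indep (⨆ k, MeasurableSpace.comap (u k) (borel X₂))
        (⨆ k, ((⨆ x : X₁, MeasurableSpace.comap (fun ω => F k ω x) (borel X₁)) ⊔
          (⨆ y : X₂, MeasurableSpace.comap (fun ω => G k ω y) (borel X₁)))) P)
    -- (i) `{I − F(k)}` is `L₂²`-stable with respect to `{𝓕(k)}`
    (hstab : L2SqStable P (fun k ω => (1 : X₁ →L[ℝ] X₁) - F k ω)
        (fun k => filtFGu F G u (k + 1)))
    -- (ii) conditional fourth-moment bound
    (γ : ℕ → ℝ) (hγ_nonneg : ∀ k, 0 ≤ γ k) (hγ_sum : Summable γ)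
    (hγ_int : ∀ k, Integrable (fun ω => ‖(1 : X₁ →L[ℝ] X₁) - F k ω‖ ^ 4) P)
    (hγ_bdd : ∀ k, P[fun ω => ‖(1 : X₁ →L[ℝ] X₁) - F k ω‖ ^ 4 | filtFGu F G u k]
        ≤ᵐ[P] fun _ => 1 + γ k)
    -- (iii) moment conditions on `G(k)`
    (hG_sum : (∑' k, ∫⁻ ω, (‖G k ω‖₊ : ℝ≥0∞) ^ 2 ∂P) < ⊤)
    (hG_bdd : (⨆ k, ∫⁻ ω, (‖G k ω‖₊ : ℝ≥0∞) ^ 4 ∂P) < ⊤) :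
    Tendsto (fun k => ∫⁻ ω, (‖x k ω‖₊ : ℝ≥0∞) ^ 2 ∂P) atTop (nhds 0) := by
  obtain ⟨c, hc⟩ := hx_init
  set A : ℕ → Ω → (X₁ →L[ℝ] X₁) := fun k ω => (1 : X₁ →L[ℝ] X₁) - F k ω
  have hle := filtFGu_le hF_meas hG_meas hu_meas
  have hA_filt : ∀ {s k : ℕ}, s < k → ∀ v, StronglyMeasurable[filtFGu F G u k] fun ω => A s ω v :=
    fun h v => by
      exact (stronglyMeasurable_const (b := v)).sub (stronglyMeasurable_filtFGu_left hF_meas h v)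
  have hstep : ∀ k (y : Ω → X₁), StronglyMeasurable[filtFGu F G u k] y →
      ∫⁻ ω, ‖A k ω (y ω)‖ₑ ^ 2 ∂P ≤ ENNReal.ofReal (1 + γ k) * ∫⁻ ω, ‖y ω‖ₑ ^ 2 ∂P :=
    fun k y hy => lintegral_enorm_clm_apply_sq_le_of_condExp_le (hle k) (hγ_nonneg k) (hγ_int k)
      (hγ_bdd k) hy
  have hstab' : ∀ n (z : Ω → X₁), StronglyMeasurable[filtFGu F G u (n + 1)] z →
      ∫⁻ ω, ‖z ω‖ₑ ^ 2 ∂P < ⊤ → Tendsto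
        (fun m => ∫⁻ ω, ‖opProdIoc (fun j => A j ω) n m (z ω)‖ₑ ^ 2 ∂P) atTop (nhds 0) := by
    intro n z hz hz2
    have h := hstab (fun k => if k = n then z else 0) (fun k => ?_) ?_ n
    · simpa [enorm_eq_nnnorm] using h
    · by_cases hk : k = n
      · subst hk
        simpa using hz
      · simpa [hk] using stronglyMeasurable_zero
    · refine lt_of_le_of_lt (iSup_le fun k => ?_) hz2
      by_cases hk : k = n
      · simp [hk, enorm_eq_nnnorm]
      · simp [hk]
  -- the contribution of the noise at time `i` to the state at time `m + 1`
  let y : ℕ → ℕ → Ω → X₁ := fun i m ω => opProdIoc (fun j => A j ω) i m (G i ω (u i ω))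
  have hu_filt : ∀ i, StronglyMeasurable[filtFGu F G u (i + 1)] (u i) := fun i =>
    stronglyMeasurable_of_comap_borel_le (hu_meas i) (comap_le_filtFGu (Nat.lt_succ_self i))
  have hGu_filt : ∀ i, StronglyMeasurable[filtFGu F G u (i + 1)] fun ω => G i ω (u i ω) :=
    fun i => stronglyMeasurable_clm_apply_of_forall
      (stronglyMeasurable_filtFGu_mid hG_meas (Nat.lt_succ_self i)) (hu_filt i)
  have hmono : Monotone (filtFGu F G u) := fun a b hab =>
    biSup_mono fun s hs => Finset.mem_range.2 ((Finset.mem_range.1 hs).trans_le hab)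
  have hy_filt : ∀ i m, i ≤ m → StronglyMeasurable[filtFGu F G u (m + 1)] (y i m) :=
    fun i m him => stronglyMeasurable_opProdIoc_apply
      (fun j hj => hA_filt (Nat.lt_succ_of_le (Finset.mem_Ioc.1 hj).2))
      ((hGu_filt i).mono (hmono (by omega)))
  have hmFG_le : sigmaFG F G ≤ ‹MeasurableSpace Ω› := iSup_le fun k => sup_le
    (iSup_le fun v => comap_borel_le_of_stronglyMeasurable (hF_meas k v))
    (iSup_le fun v => comap_borel_le_of_stronglyMeasurable (hG_meas k v))
  have hmU_le : sigmaNoise u ≤ ‹MeasurableSpace Ω› := iSup_le fun k =>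
    comap_borel_le_of_stronglyMeasurable (hu_meas k)
  have hA_FG : ∀ k v, StronglyMeasurable[sigmaFG F G] fun ω => A k ω v := fun k v => by
    have : StronglyMeasurable[sigmaFG F G] fun ω => F k ω v :=
      stronglyMeasurable_of_comap_borel_le (hF_meas k v) (le_iSup_of_le k (le_sup_of_le_left
        (le_iSup (fun x => MeasurableSpace.comap (fun ω => F k ω x) (borel X₁)) v)))
    exact (stronglyMeasurable_const (b := v)).sub this
  have hG_FG : ∀ k v, StronglyMeasurable[sigmaFG F G] fun ω => G k ω v := fun k v =>
    stronglyMeasurable_of_comap_borel_le (hG_meas k v) (le_iSup_of_le k (le_sup_of_le_right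
      (le_iSup (fun y => MeasurableSpace.comap (fun ω => G k ω y) (borel X₁)) v)))
  have hu_U : ∀ k, StronglyMeasurable[sigmaNoise u] (u k) := fun k =>
    stronglyMeasurable_of_comap_borel_le (hu_meas k)
      (le_iSup (fun k => MeasurableSpace.comap (u k) (borel X₂)) k)
  -- second moments of the noise contributions
  set U := ⨆ k, ∫⁻ ω, (‖u k ω‖₊ : ℝ≥0∞) ^ 2 ∂P
  have hGu2 : ∀ i, ∫⁻ ω, ‖G i ω (u i ω)‖ₑ ^ 2 ∂P
      ≤ (∫⁻ ω, (‖G i ω‖₊ : ℝ≥0∞) ^ 2 ∂P) * U := by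
    intro i
    obtain ⟨d, hd, hdG, hdu⟩ := exists_measurable_enorm_clm_apply_le (hG_FG i) (hu_meas i)
    calc ∫⁻ ω, ‖G i ω (u i ω)‖ₑ ^ 2 ∂P
        ≤ ∫⁻ ω, ‖u i ω‖ₑ ^ 2 * d ω ^ 2 ∂P := lintegral_mono fun ω => by
          rw [← mul_pow, mul_comm]
          exact pow_le_pow_left' (hdu ω) 2
      _ = (∫⁻ ω, ‖u i ω‖ₑ ^ 2 ∂P) * ∫⁻ ω, d ω ^ 2 ∂P :=
          lintegral_mul_eq_lintegral_mul_lintegral_of_independent_measurableSpace hmU_le hmFG_le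
            hindep ((hu_U i).enorm.pow_const 2) (hd.pow_const 2)
      _ ≤ _ := by
          rw [mul_comm]
          gcongr
          · exact hdG _
          · exact le_iSup (fun k => ∫⁻ ω, (‖u k ω‖₊ : ℝ≥0∞) ^ 2 ∂P) i
  set K := ENNReal.ofReal (Real.exp (∑' k, γ k))
  have hy2 : ∀ i m, ∫⁻ ω, ‖y i m ω‖ₑ ^ 2 ∂P
      ≤ K * ((∫⁻ ω, (‖G i ω‖₊ : ℝ≥0∞) ^ 2 ∂P) * U) := by
    intro i m
    have hbase : ∀ m ≤ i, ∫⁻ ω, ‖y i m ω‖ₑ ^ 2 ∂P ≤ ∫⁻ ω, ‖G i ω (u i ω)‖ₑ ^ 2 ∂P :=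
      fun m hm => by simp [y, opProdIoc_of_le _ hm]
    have hpartial : ∫⁻ ω, ‖y i m ω‖ₑ ^ 2 ∂P
        ≤ ENNReal.ofReal (Real.exp (∑ k ∈ Finset.range (m + 1), γ k))
          * ∫⁻ ω, ‖G i ω (u i ω)‖ₑ ^ 2 ∂P := by
      have hone : ∀ m, 1 ≤ ENNReal.ofReal (Real.exp (∑ k ∈ Finset.range (m + 1), γ k)) :=
        fun m => by
          rw [ENNReal.one_le_ofReal]
          exact Real.one_le_exp (Finset.sum_nonneg fun k _ => hγ_nonneg k)
      induction m with
      | zero => exact (hbase 0 (Nat.zero_le i)).trans (le_mul_of_one_le_left' (hone 0))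
      | succ m ih =>
        rcases Nat.lt_or_ge m i with h | h
        · exact (hbase (m + 1) h).trans (le_mul_of_one_le_left' (hone (m + 1)))
        · have hs := hstep (m + 1) (y i m) (hy_filt i m h)
          have heq : ∀ ω, A (m + 1) ω (y i m ω) = y i (m + 1) ω := fun ω => by
            simp [y, opProdIoc_succ _ h]
          simp only [heq] at hs
          refine hs.trans ((mul_le_mul' le_rfl ih).trans ?_)
          rw [← mul_assoc, ← ENNReal.ofReal_mul (by linarith [hγ_nonneg (m + 1)]),
            Finset.sum_range_succ _ (m + 1), Real.exp_add, mul_comm (1 + γ (m + 1))]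
          gcongr
          linarith [Real.add_one_le_exp (γ (m + 1))]
    refine hpartial.trans (mul_le_mul' (ENNReal.ofReal_le_ofReal (Real.exp_le_exp.2 ?_)) (hGu2 i))
    exact hγ_sum.sum_le_tsum _ fun k _ => hγ_nonneg k
  have hdom : ∑' i, K * ((∫⁻ ω, (‖G i ω‖₊ : ℝ≥0∞) ^ 2 ∂P) * U) ≠ ⊤ := by
    rw [ENNReal.tsum_mul_left, ENNReal.tsum_mul_right]
    exact ENNReal.mul_ne_top ENNReal.ofReal_ne_top (ENNReal.mul_ne_top hG_sum.ne hu_bdd.ne)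
  have hy2_top : ∀ i m, ∫⁻ ω, ‖y i m ω‖ₑ ^ 2 ∂P ≠ ⊤ := fun i m =>
    ne_top_of_le_ne_top (ENNReal.ne_top_of_tsum_ne_top hdom i) (hy2 i m)
  have hy_lim : ∀ i, Tendsto (fun m => ∫⁻ ω, ‖y i m ω‖ₑ ^ 2 ∂P) atTop (nhds 0) := fun i =>
    hstab' i _ (hGu_filt i) (by simpa [y, opProdIoc_self] using (hy2_top i i).lt_top)
  -- the noise contributions are pairwise orthogonal
  have hsum : ∀ m j, j ≤ m + 1 → ∫⁻ ω, ‖∑ i ∈ Finset.range j, y i m ω‖ₑ ^ 2 ∂P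
      = ∑ i ∈ Finset.range j, ∫⁻ ω, ‖y i m ω‖ₑ ^ 2 ∂P := by
    intro m j
    induction j with
    | zero => simp
    | succ j ih =>
      intro hj
      have ih := ih (by omega)
      have hPastU : sigmaPastNoise u j ≤ sigmaNoise u := iSup₂_le fun s _ =>
        le_iSup (fun k => MeasurableSpace.comap (u k) (borel X₂)) s
      have hPast_filt : sigmaPastNoise u j ≤ filtFGu F G u j := iSup₂_le fun s hs =>
        comap_le_filtFGu (Finset.mem_range.1 hs)
      have hcond : P[u j | sigmaFG F G ⊔ sigmaPastNoise u j] =ᵐ[P] 0 := by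
        refine condExp_sup_eq_zero_of_indep hmFG_le hPastU hmU_le hindep (hu_U j) (hu_int j)
          fun s hs => ?_
        rw [← setIntegral_condExp (hle j) (hu_int j) (hPast_filt s hs),
          setIntegral_congr_ae (g := fun _ => 0) (hle j s (hPast_filt s hs))
            ((hu_mds j).mono fun ω hω _ => hω)]
        simp
      have hFG_sup : sigmaFG F G ≤ sigmaFG F G ⊔ sigmaPastNoise u j := le_sup_left
      have hs : StronglyMeasurable[sigmaFG F G ⊔ sigmaPastNoise u j] fun ω => ∑ i ∈ Finset.range j, y i m ω := by
        refine Finset.stronglyMeasurable_fun_sum _ fun i hi => ?_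
        have hu_i : StronglyMeasurable[sigmaFG F G ⊔ sigmaPastNoise u j] (u i) :=
          stronglyMeasurable_of_comap_borel_le (hu_meas i)
            ((le_iSup₂_of_le i hi le_rfl : _ ≤ sigmaPastNoise u j).trans le_sup_right)
        exact stronglyMeasurable_opProdIoc_apply (fun k _ v => (hA_FG k v).mono hFG_sup)
          (stronglyMeasurable_clm_apply_of_forall (fun v => (hG_FG i v).mono hFG_sup) hu_i)
      have hadd := lintegral_enorm_add_clm_apply_sq_of_condExp_eq_zero
        (sup_le hmFG_le (hPastU.trans hmU_le)) hs
        (B := fun ω => (opProdIoc (fun k => A k ω) j m).comp (G j ω))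
        (fun v => stronglyMeasurable_opProdIoc_apply (fun k _ v => (hA_FG k v).mono hFG_sup)
          ((hG_FG j v).mono hFG_sup)) (hu_meas j) (hu_int j) hcond
        (by rw [ih]; exact ENNReal.sum_ne_top.2 fun i _ => hy2_top i m) (hy2_top j m)
      simp only [Finset.sum_range_succ]
      rw [← ih]
      exact hadd
  -- the variation of constants formula
  have hx : ∀ m ω, x (m + 1) ω = opProdIoc (fun j => A j ω) 0 m (A 0 ω c)
      + ∑ i ∈ Finset.range (m + 1), y i m ω := by
    intro m ω
    induction m with
    | zero => simp [hx_rec, hc, y, A, opProdIoc_self]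
    | succ m ih =>
      rw [hx_rec, ih, Finset.sum_range_succ _ (m + 1), map_add, map_sum, add_assoc,
        opProdIoc_succ _ (Nat.zero_le m)]
      have : ∀ i ∈ Finset.range (m + 1), A (m + 1) ω (y i m ω) = y i (m + 1) ω := fun i hi => by
        simp [y, opProdIoc_succ _ (Nat.lt_succ_iff.1 (Finset.mem_range.1 hi))]
      rw [← Finset.sum_congr rfl this]
      simp [y, opProdIoc_self, A]
  have hinit : Tendsto (fun m => ∫⁻ ω, ‖opProdIoc (fun j => A j ω) 0 m (A 0 ω c)‖ₑ ^ 2 ∂P)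
      atTop (nhds 0) := by
    refine hstab' 0 _ (hA_filt Nat.zero_lt_one c)
      ((hstep 0 (fun _ => c) stronglyMeasurable_const).trans_lt ?_)
    simp [ENNReal.mul_lt_top]
  have hnoise := ENNReal.tendsto_tsum_nhds_zero_of_dominated hdom hy2 hy_lim
  have hlim := (ENNReal.Tendsto.const_mul (a := 2) (hinit.add hnoise) (by simp))
  rw [add_zero, mul_zero] at hlim
  refine (tendsto_add_atTop_iff_nat 1).1
    (tendsto_of_tendsto_of_tendsto_of_le_of_le tendsto_const_nhds hlim (fun _ => zero_le)
      fun m => ?_)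
  have hmeas : StronglyMeasurable fun ω => opProdIoc (fun j => A j ω) 0 m (A 0 ω c) :=
    stronglyMeasurable_opProdIoc_apply (fun j _ v => (hA_FG j v).mono hmFG_le)
      ((hA_FG 0 c).mono hmFG_le)
  calc ∫⁻ ω, ‖x (m + 1) ω‖ₑ ^ 2 ∂P
      ≤ ∫⁻ ω, 2 * (‖opProdIoc (fun j => A j ω) 0 m (A 0 ω c)‖ₑ ^ 2
          + ‖∑ i ∈ Finset.range (m + 1), y i m ω‖ₑ ^ 2) ∂P := lintegral_mono fun ω => by
        rw [hx]
        refine (pow_le_pow_left' (enorm_add_le _ _) 2).trans ?_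
        have h := ENNReal.rpow_add_le_mul_rpow_add_rpow
          ‖opProdIoc (fun j => A j ω) 0 m (A 0 ω c)‖ₑ
          ‖∑ i ∈ Finset.range (m + 1), y i m ω‖ₑ one_le_two
        norm_num at h
        exact h
    _ = 2 * (∫⁻ ω, ‖opProdIoc (fun j => A j ω) 0 m (A 0 ω c)‖ₑ ^ 2 ∂P
          + ∑ i ∈ Finset.range (m + 1), ∫⁻ ω, ‖y i m ω‖ₑ ^ 2 ∂P) := by
        rw [lintegral_const_mul' _ _ (by simp), lintegral_add_left (hmeas.enorm.pow_const 2),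
          hsum m (m + 1) le_rfl]
    _ ≤ _ := by
        gcongr
        exact ENNReal.sum_le_tsum _
end
end

section
/- For the decentralized online learning algorithm in the reproducing kernel Hilbert space H_K, suppose 𝒢 is connected and Assumptions A3, A4, A5 and Conditions C1, C2, C3 hold. If there exist positive self-adjoint operators N₁, …, N_N ∈ L(H_K) with ∑_{i=1}^N Nᵢ strictly positive and an integer h > 0 such that for every sequence {g(k)} of H_K-valued strongly measurable random elements with g(k) 𝓕(kh−1)-measurable and sup_k E[‖g(k)‖²_K] < ∞ one has ∑_{j=1}^N ∑_{k=0}^∞ E[‖(N_j − ∑_{i=kh}^{(k+1)h−1} E[K_{x_j(i)} ⊗ K_{x_j(i)} | 𝓕(kh−1)]) g(k)‖²_K] < ∞, then the algorithm is both mean square consistent and almost surely strongly consistent. -/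
open MeasureTheory ProbabilityTheory Filter ENNReal RealInnerProductSpace

noncomputable section

/-- The rank-one operator `φ ⊗ ψ ∈ L(H)`, `(φ ⊗ ψ) f = ⟪f, ψ⟫ φ`. -/
def rankOne {H : Type*} [NormedAddCommGroup H] [InnerProductSpace ℝ H] (φ ψ : H) : H →L[ℝ] H :=
  (innerSL ℝ ψ).smulRight φ

/-- The σ-algebra `𝓕(k−1)` generated by the random variables `f(x_i(s)) = ⟪f, K_{x_i(s)}⟫`
(`f ∈ H_K`, `i ∈ V`) and `v_i(s)` (`i ∈ V`) for `0 ≤ s ≤ k−1` (so `rkhsFilt Kx xi v 0` is the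
trivial σ-algebra `𝓕(−1)`). -/
def rkhsFilt {Ω S HK : Type*} [MeasurableSpace Ω]
    [NormedAddCommGroup HK] [InnerProductSpace ℝ HK]
    {N : ℕ} (Kx : S → HK) (xi : Fin N → ℕ → Ω → S) (v : Fin N → ℕ → Ω → ℝ) (k : ℕ) :
    MeasurableSpace Ω :=
  ⨆ s ∈ Finset.range k, ⨆ i : Fin N,
    ((⨆ g : HK, MeasurableSpace.comap (fun ω => ⟪g, Kx (xi i s ω)⟫) (borel ℝ)) ⊔
      MeasurableSpace.comap (fun ω => v i s ω) (borel ℝ))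

/-- A bounded symmetric operator with nonnegative quadratic form satisfies
`‖T x‖² ≤ c ⟪T x, x⟫`. -/
lemma norm_sq_le_mul_inner_of_isSymmetric {G : Type*} [NormedAddCommGroup G]
    [InnerProductSpace ℝ G] {T : G →ₗ[ℝ] G} (hs : T.IsSymmetric) (hp : ∀ x, 0 ≤ ⟪T x, x⟫)
    {c : ℝ} (hc : 0 < c) (hb : ∀ x, ‖T x‖ ≤ c * ‖x‖) (x : G) :
    ‖T x‖ ^ 2 ≤ c * ⟪T x, x⟫ := by
  have h1 := hp (x - c⁻¹ • T x)
  have h2 : ⟪T (x - c⁻¹ • T x), x - c⁻¹ • T x⟫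
      = ⟪T x, x⟫ - 2 * c⁻¹ * ‖T x‖ ^ 2 + c⁻¹ ^ 2 * ⟪T (T x), T x⟫ := by
    rw [map_sub, map_smul, inner_sub_left, inner_sub_right, inner_sub_right,
      inner_smul_left, inner_smul_right, inner_smul_right, inner_smul_left, hs (T x) x,
      real_inner_self_eq_norm_sq]
    simp only [conj_trivial]
    ring
  have h3 : ⟪T (T x), T x⟫ ≤ c * ‖T x‖ ^ 2 := by
    calc ⟪T (T x), T x⟫ ≤ ‖T (T x)‖ * ‖T x‖ := real_inner_le_norm _ _
      _ ≤ (c * ‖T x‖) * ‖T x‖ := by gcongr; exact hb _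
      _ = c * ‖T x‖ ^ 2 := by ring
  have h4 : c⁻¹ ^ 2 * ⟪T (T x), T x⟫ ≤ c⁻¹ * ‖T x‖ ^ 2 := by
    calc c⁻¹ ^ 2 * ⟪T (T x), T x⟫ ≤ c⁻¹ ^ 2 * (c * ‖T x‖ ^ 2) := by gcongr
      _ = c⁻¹ * ‖T x‖ ^ 2 := by field_simp
  have h5 : c⁻¹ * ‖T x‖ ^ 2 ≤ ⟪T x, x⟫ := by
    rw [h2] at h1
    linarith
  calc ‖T x‖ ^ 2 = c * (c⁻¹ * ‖T x‖ ^ 2) := by field_simp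
    _ ≤ c * ⟪T x, x⟫ := by gcongr

lemma norm_sub_smul_sq_add_le {G : Type*} [NormedAddCommGroup G]
    [InnerProductSpace ℝ G] {T : G →ₗ[ℝ] G} (hs : T.IsSymmetric) (hp : ∀ x, 0 ≤ ⟪T x, x⟫)
    {c : ℝ} (hc : 0 < c) (hb : ∀ x, ‖T x‖ ≤ c * ‖x‖) {t : ℝ} (ht : 0 ≤ t) (htc : t * c ≤ 1)
    (x : G) : ‖x - t • T x‖ ^ 2 + t * ⟪T x, x⟫ ≤ ‖x‖ ^ 2 := by
  rw [norm_sub_sq_real, inner_smul_right, norm_smul, Real.norm_of_nonneg ht, real_inner_comm]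
  have h1 := norm_sq_le_mul_inner_of_isSymmetric hs hp hc hb x
  have h2 : (t * ‖T x‖) ^ 2 ≤ t * ⟪T x, x⟫ := by
    calc (t * ‖T x‖) ^ 2 = t * (t * ‖T x‖ ^ 2) := by ring
      _ ≤ t * (t * (c * ⟪T x, x⟫)) := by gcongr
      _ = t * ((t * c) * ⟪T x, x⟫) := by ring
      _ ≤ t * (1 * ⟪T x, x⟫) := by
        have := hp x
        gcongr
      _ = t * ⟪T x, x⟫ := by ring
  linarith

lemma norm_sub_smul_le {G : Type*} [NormedAddCommGroup G]
    [InnerProductSpace ℝ G] {T : G →ₗ[ℝ] G} (hs : T.IsSymmetric) (hp : ∀ x, 0 ≤ ⟪T x, x⟫)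
    {c : ℝ} (hc : 0 < c) (hb : ∀ x, ‖T x‖ ≤ c * ‖x‖) {t : ℝ} (ht : 0 ≤ t) (htc : t * c ≤ 1)
    (x : G) : ‖x - t • T x‖ ≤ ‖x‖ := by
  have h1 := norm_sub_smul_sq_add_le hs hp hc hb ht htc x
  have h2 := mul_nonneg ht (hp x)
  exact (sq_le_sq₀ (norm_nonneg _) (norm_nonneg _)).1 (by linarith)

lemma tendsto_zero_of_antitone_of_summable_mul {α u : ℕ → ℝ} (hα : ∀ k, 0 ≤ α k)
    (hαs : ¬ Summable α) (hu : Antitone u) (hu0 : ∀ k, 0 ≤ u k)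
    (hs : Summable fun k => α k * u k) : Tendsto u atTop (nhds 0) := by
  have hbdd : BddBelow (Set.range u) := ⟨0, by rintro _ ⟨k, rfl⟩; exact hu0 k⟩
  have hlim := tendsto_atTop_ciInf hu hbdd
  have hle : ∀ k, ⨅ i, u i ≤ u k := fun k => ciInf_le hbdd k
  have h0 : 0 ≤ ⨅ i, u i := le_ciInf hu0
  rcases h0.eq_or_lt with h | h
  · rwa [← h] at hlim
  · refine absurd ?_ hαs
    have h1 : Summable fun k => α k * ⨅ i, u i :=
      Summable.of_nonneg_of_le (fun k => mul_nonneg (hα k) h0)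
        (fun k => mul_le_mul_of_nonneg_left (hle k) (hα k)) hs
    exact (summable_mul_right_iff h.ne').1 h1

/-- The product `(1 - α (k - 1) T) ⋯ (1 - α 0 T)`. -/
def contractionProd {G : Type*} [NormedAddCommGroup G] [InnerProductSpace ℝ G]
    (T : G →ₗ[ℝ] G) (α : ℕ → ℝ) : ℕ → G →ₗ[ℝ] G
  | 0 => LinearMap.id
  | k + 1 => (LinearMap.id - α k • T) ∘ₗ contractionProd T α k

lemma contractionProd_succ_apply {G : Type*} [NormedAddCommGroup G] [InnerProductSpace ℝ G]
    (T : G →ₗ[ℝ] G) (α : ℕ → ℝ) (k : ℕ) (x : G) :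
    contractionProd T α (k + 1) x
      = contractionProd T α k x - α k • T (contractionProd T α k x) := rfl

lemma contractionProd_comm {G : Type*} [NormedAddCommGroup G] [InnerProductSpace ℝ G]
    (T : G →ₗ[ℝ] G) (α : ℕ → ℝ) (k : ℕ) (x : G) :
    contractionProd T α k (T x) = T (contractionProd T α k x) := by
  induction k with
  | zero => rfl
  | succ k ih => simp only [contractionProd_succ_apply, ih, map_sub, map_smul]

/-- The products of `1 - α k T` tend strongly to zero when `T` is strictly positive and
`∑ α k = ∞`. -/
lemma tendsto_contractionProd {G : Type*} [NormedAddCommGroup G] [InnerProductSpace ℝ G]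
    [CompleteSpace G] {T : G →ₗ[ℝ] G} (hs : T.IsSymmetric) (hp : ∀ x, x ≠ 0 → 0 < ⟪T x, x⟫)
    {c : ℝ} (hc : 0 < c) (hb : ∀ x, ‖T x‖ ≤ c * ‖x‖) {α : ℕ → ℝ} (hα : ∀ k, 0 ≤ α k)
    (hαc : ∀ k, α k * c ≤ 1) (hαs : ¬ Summable α) (x : G) :
    Tendsto (fun k => contractionProd T α k x) atTop (nhds 0) := by
  have hp' : ∀ x, 0 ≤ ⟪T x, x⟫ := fun x => by
    rcases eq_or_ne x 0 with rfl | hx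
    · simp
    · exact (hp x hx).le
  have hstep : ∀ x k, ‖contractionProd T α (k + 1) x‖ ≤ ‖contractionProd T α k x‖ := fun x k =>
    norm_sub_smul_le hs hp' hc hb (hα k) (hαc k) _
  have hnorm : ∀ x k, ‖contractionProd T α k x‖ ≤ ‖x‖ := fun x k => by
    induction k with
    | zero => exact le_rfl
    | succ k ih => exact (hstep x k).trans ih
  have hrange : ∀ y, Tendsto (fun k => ‖contractionProd T α k (T y)‖) atTop (nhds 0) := fun y => by
    have h1 : Summable fun k => α k * ‖contractionProd T α k (T y)‖ ^ 2 := by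
      refine summable_of_sum_range_le (c := c * ‖y‖ ^ 2)
        (fun k => mul_nonneg (hα k) (sq_nonneg _)) fun n => ?_
      have h2 : ∑ k ∈ Finset.range n, α k * ‖contractionProd T α k (T y)‖ ^ 2
          ≤ c * (‖y‖ ^ 2 - ‖contractionProd T α n y‖ ^ 2) := by
        induction n with
        | zero => simp [contractionProd]
        | succ n ih =>
          rw [Finset.sum_range_succ, contractionProd_comm]
          have h3 := norm_sub_smul_sq_add_le hs hp' hc hb (hα n) (hαc n) (contractionProd T α n y)
          rw [← contractionProd_succ_apply] at h3
          have h4 := norm_sq_le_mul_inner_of_isSymmetric hs hp' hc hb (contractionProd T α n y)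
          have h5 := mul_le_mul_of_nonneg_left h4 (hα n)
          have h6 := mul_le_mul_of_nonneg_left h3 hc.le
          linarith
      have h7 : 0 ≤ c * ‖contractionProd T α n y‖ ^ 2 := by positivity
      linarith
    have h2 := tendsto_zero_of_antitone_of_summable_mul hα hαs
      (antitone_nat_of_succ_le fun k => by gcongr; exact hstep (T y) k) (fun k => sq_nonneg _) h1
    have h3 := h2.sqrt
    simpa [Real.sqrt_sq (norm_nonneg _)] using h3
  have hdense : x ∈ closure (LinearMap.range T : Set G) := by
    have h1 : (LinearMap.range T)ᗮ = ⊥ := by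
      rw [Submodule.eq_bot_iff]
      intro z hz
      by_contra hz0
      have h2 := hp z hz0
      have h3 := (Submodule.mem_orthogonal _ _).1 hz (T z) ⟨z, rfl⟩
      linarith
    have h2 := Submodule.topologicalClosure_eq_top_iff.2 h1
    have h3 : x ∈ (LinearMap.range T).topologicalClosure := h2 ▸ Submodule.mem_top
    exact h3
  rw [tendsto_zero_iff_norm_tendsto_zero, Metric.tendsto_atTop]
  intro ε hε
  obtain ⟨_, ⟨y, rfl⟩, hy⟩ := Metric.mem_closure_iff.1 hdense (ε / 2) (half_pos hε)
  obtain ⟨n, hn⟩ := Metric.tendsto_atTop.1 (hrange y) (ε / 2) (half_pos hε)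
  refine ⟨n, fun k hk => ?_⟩
  have h1 := hn k hk
  simp only [dist_zero_right, norm_norm] at h1 ⊢
  calc ‖contractionProd T α k x‖
      = ‖contractionProd T α k (x - T y) + contractionProd T α k (T y)‖ := by
        rw [← map_add, sub_add_cancel]
    _ ≤ ‖contractionProd T α k (x - T y)‖ + ‖contractionProd T α k (T y)‖ := norm_add_le _ _
    _ < ε / 2 + ε / 2 := add_lt_add ((hnorm _ k).trans_lt (by rwa [← dist_eq_norm])) h1
    _ = ε := add_halves ε

/-- A perturbed recursion `x (k + 1) = x k - α k T (x k) + r k + μ k` with summable errors `r k`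
and square summable, orthogonal increments `μ k` tends to zero. -/
lemma tendsto_zero_of_perturbed_recursion {G : Type*} [NormedAddCommGroup G]
    [InnerProductSpace ℝ G]
    [CompleteSpace G] {T : G →ₗ[ℝ] G} (hs : T.IsSymmetric) (hp : ∀ x, x ≠ 0 → 0 < ⟪T x, x⟫)
    {c : ℝ} (hc : 0 < c) (hb : ∀ x, ‖T x‖ ≤ c * ‖x‖) {α : ℕ → ℝ} (hα : ∀ k, 0 ≤ α k)
    (hα0 : Tendsto α atTop (nhds 0)) (hαs : ¬ Summable α)
    {x r μ : ℕ → G} (hx : ∀ k, x (k + 1) = x k - α k • T (x k) + r k + μ k)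
    (hr : Summable fun k => ‖r k‖) (hμ : Summable fun k => ‖μ k‖ ^ 2)
    (W : ℕ → Submodule ℝ G) (hW : Monotone W) (hTW : ∀ k, ∀ y ∈ W k, T y ∈ W k)
    (hμW : ∀ k, μ k ∈ W (k + 1)) (hμo : ∀ k, ∀ y ∈ W k, ⟪y, μ k⟫ = 0) :
    Tendsto x atTop (nhds 0) := by
  have hp' : ∀ x, 0 ≤ ⟪T x, x⟫ := fun x => by
    rcases eq_or_ne x 0 with rfl | hx
    · simp
    · exact (hp x hx).le
  rw [tendsto_zero_iff_norm_tendsto_zero, Metric.tendsto_atTop]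
  intro ε hε
  have e1 : ∀ᶠ m in atTop, α m * c < 1 := by
    have : Tendsto (fun m => α m * c) atTop (nhds (0 * c)) := hα0.mul_const c
    rw [zero_mul] at this
    exact this.eventually_lt_const one_pos
  have e2 : ∀ᶠ m in atTop, ∑' k, ‖r (k + m)‖ < ε / 3 :=
    (_root_.tendsto_sum_nat_add fun k => ‖r k‖).eventually_lt_const (by positivity)
  have e3 : ∀ᶠ m in atTop, ∑' k, ‖μ (k + m)‖ ^ 2 < (ε / 3) ^ 2 :=
    (_root_.tendsto_sum_nat_add fun k => ‖μ k‖ ^ 2).eventually_lt_const (by positivity)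
  obtain ⟨m, hm⟩ := eventually_atTop.1 (e1.and (e2.and e3))
  have hαc : ∀ k, α (k + m) * c ≤ 1 := fun k => (hm (k + m) (by lia)).1.le
  obtain ⟨-, hm2, hm3⟩ := hm m le_rfl
  have hcontr : ∀ k y, ‖y - α (k + m) • T y‖ ≤ ‖y‖ := fun k y =>
    norm_sub_smul_le hs hp' hc hb (hα _) (hαc k) y
  let p : ℕ → G := fun k => Nat.rec 0 (fun k y => y - α (k + m) • T y + r (k + m)) k
  let d : ℕ → G := fun k => Nat.rec 0 (fun k y => y - α (k + m) • T y + μ (k + m)) k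
  have hps : ∀ k, p (k + 1) = p k - α (k + m) • T (p k) + r (k + m) := fun k => rfl
  have hds : ∀ k, d (k + 1) = d k - α (k + m) • T (d k) + μ (k + m) := fun k => rfl
  let u : ℕ → G := fun k => contractionProd T (fun k => α (k + m)) k (x m)
  have hdecomp : ∀ k, x (k + m) = u k + p k + d k := fun k => by
    induction k with
    | zero => simp [u, p, d, contractionProd]
    | succ k ih =>
      have : k + 1 + m = k + m + 1 := by ring
      rw [this, hx, hps, hds, ih]
      simp only [u, contractionProd_succ_apply, map_add, smul_add]
      abel
  have hpn : ∀ k, ‖p k‖ ≤ ε / 3 := fun k => by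
    have h1 : ‖p k‖ ≤ ∑ i ∈ Finset.range k, ‖r (i + m)‖ := by
      induction k with
      | zero => simp [p]
      | succ k ih =>
        rw [hps, Finset.sum_range_succ]
        exact (norm_add_le _ _).trans (add_le_add ((hcontr k _).trans ih) le_rfl)
    have h2 := ((summable_nat_add_iff m).2 hr).sum_le_tsum (Finset.range k)
      (fun i _ => norm_nonneg _)
    linarith
  have hdW : ∀ k, d k ∈ W (k + m) := fun k => by
    induction k with
    | zero => exact Submodule.zero_mem _
    | succ k ih =>
      rw [hds, show k + 1 + m = k + m + 1 by ring]
      refine Submodule.add_mem _ (hW (Nat.le_succ _) ?_) (hμW _)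
      exact Submodule.sub_mem _ ih (Submodule.smul_mem _ _ (hTW _ _ ih))
  have hdn : ∀ k, ‖d k‖ ≤ ε / 3 := fun k => by
    have h1 : ‖d k‖ ^ 2 ≤ ∑ i ∈ Finset.range k, ‖μ (i + m)‖ ^ 2 := by
      induction k with
      | zero => simp [d]
      | succ k ih =>
        rw [hds, Finset.sum_range_succ, norm_add_sq_real, hμo (k + m) _
          (Submodule.sub_mem _ (hdW k) (Submodule.smul_mem _ _ (hTW _ _ (hdW k))))]
        have := pow_le_pow_left₀ (norm_nonneg _) (hcontr k (d k)) 2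
        linarith
    have h2 := ((summable_nat_add_iff m).2 hμ).sum_le_tsum (Finset.range k)
      (fun i _ => sq_nonneg _)
    exact (sq_le_sq₀ (norm_nonneg _) (by positivity)).1 (by linarith)
  have hu : Tendsto u atTop (nhds 0) :=
    tendsto_contractionProd hs hp hc hb (fun k => hα _) hαc
      (fun h => hαs ((summable_nat_add_iff m).1 h)) (x m)
  obtain ⟨n, hn⟩ := Metric.tendsto_atTop.1 hu (ε / 3) (by positivity)
  refine ⟨n + m, fun k hk => ?_⟩
  obtain ⟨l, rfl⟩ := Nat.exists_eq_add_of_le' (show m ≤ k by lia)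
  have h1 := hn l (by lia)
  simp only [dist_zero_right, norm_norm] at h1 ⊢
  rw [hdecomp]
  have h2 := norm_add₃_le (a := u l) (b := p l) (c := d l)
  linarith [hpn l, hdn l]

lemma sum_sum_mul_inner_sub {N : ℕ} {A : Fin N → Fin N → ℝ} (hA : ∀ i j, A i j = A j i)
    {G : Type*} [NormedAddCommGroup G] [InnerProductSpace ℝ G] (x y : Fin N → G) :
    ∑ j, ∑ l, A j l * ⟪x j - x l, y j⟫ = 1 / 2 * ∑ j, ∑ l, A j l * ⟪x j - x l, y j - y l⟫ := by
  have h1 : ∑ j, ∑ l, A j l * ⟪x j - x l, y j⟫ = ∑ j, ∑ l, A j l * ⟪x l - x j, y l⟫ := by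
    rw [Finset.sum_comm]
    refine Finset.sum_congr rfl fun j _ => Finset.sum_congr rfl fun l _ => ?_
    rw [hA]
  have h2 : ∑ j, ∑ l, A j l * ⟪x j - x l, y j - y l⟫
      = ∑ j, ∑ l, A j l * ⟪x j - x l, y j⟫ + ∑ j, ∑ l, A j l * ⟪x l - x j, y l⟫ := by
    simp only [← Finset.sum_add_distrib]
    refine Finset.sum_congr rfl fun j _ => Finset.sum_congr rfl fun l _ => ?_
    rw [inner_sub_right, ← neg_sub (x j) (x l), inner_neg_left]
    ring
  rw [h2, ← h1]
  ring

/-- The operator `x ↦ (B j x_j + s ∑ l, a_{jl} (x_j - x_l))_j`: a block diagonal operator plus a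
multiple of the Laplacian of the graph with weights `A`. -/
def networkOp {N : ℕ} {G : Type*} [NormedAddCommGroup G] [InnerProductSpace ℝ G]
    (B : Fin N → G →ₗ[ℝ] G) (A : Fin N → Fin N → ℝ) (s : ℝ) :
    PiLp 2 (fun _ : Fin N => G) →ₗ[ℝ] PiLp 2 (fun _ : Fin N => G) where
  toFun x := WithLp.toLp 2 fun j => B j (x j) + s • ∑ l, A j l • (x j - x l)
  map_add' x y := by
    ext j
    have : ∀ l, A j l • (x j + y j - (x l + y l)) = A j l • (x j - x l) + A j l • (y j - y l) :=
      fun l => by rw [← smul_add]; congr 1; abel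
    simp only [PiLp.add_apply, map_add, this, Finset.sum_add_distrib, smul_add]
    abel
  map_smul' t x := by
    ext j
    have : ∀ l, A j l • (t • x j - t • x l) = t • (A j l • (x j - x l)) :=
      fun l => by rw [← smul_sub, smul_comm]
    simp only [PiLp.smul_apply, map_smul, this, ← Finset.smul_sum, RingHom.id_apply, smul_add]
    rw [smul_comm]

section networkOp

variable {N : ℕ} {G : Type*} [NormedAddCommGroup G] [InnerProductSpace ℝ G]
  {B : Fin N → G →ₗ[ℝ] G} {A : Fin N → Fin N → ℝ} {s : ℝ}

lemma networkOp_apply (B : Fin N → G →ₗ[ℝ] G) (A : Fin N → Fin N → ℝ) (s : ℝ)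
    (x : PiLp 2 (fun _ : Fin N => G)) (j : Fin N) :
    networkOp B A s x j = B j (x j) + s • ∑ l, A j l • (x j - x l) := rfl

lemma inner_networkOp (hA : ∀ i j, A i j = A j i) (x y : PiLp 2 (fun _ : Fin N => G)) :
    ⟪networkOp B A s x, y⟫ = ∑ j, ⟪B j (x j), y j⟫
      + s * (1 / 2 * ∑ j, ∑ l, A j l * ⟪x j - x l, y j - y l⟫) := by
  rw [← sum_sum_mul_inner_sub hA, PiLp.inner_apply]
  simp only [networkOp_apply, inner_add_left, Finset.sum_add_distrib, real_inner_smul_left,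
    sum_inner, Finset.mul_sum]

lemma networkOp_isSymmetric (hA : ∀ i j, A i j = A j i) (hB : ∀ j, (B j).IsSymmetric) :
    (networkOp B A s).IsSymmetric := fun x y => by
  rw [inner_networkOp hA, real_inner_comm, inner_networkOp hA]
  congr 1
  · exact Finset.sum_congr rfl fun j _ => by rw [hB j, real_inner_comm]
  · congr 2
    exact Finset.sum_congr rfl fun j _ => Finset.sum_congr rfl fun l _ => by
      rw [real_inner_comm]

lemma inner_networkOp_self_nonneg (hA : ∀ i j, A i j = A j i) (hA0 : ∀ i j, 0 ≤ A i j)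
    (hs : 0 ≤ s) (hB : ∀ j y, 0 ≤ ⟪B j y, y⟫) (x : PiLp 2 (fun _ : Fin N => G)) :
    0 ≤ ⟪networkOp B A s x, x⟫ := by
  rw [inner_networkOp hA]
  refine add_nonneg (Finset.sum_nonneg fun j _ => hB j _) (mul_nonneg hs (mul_nonneg (by norm_num)
    (Finset.sum_nonneg fun j _ => Finset.sum_nonneg fun l _ => mul_nonneg (hA0 _ _) ?_)))
  exact real_inner_self_nonneg

lemma inner_networkOp_self_pos (hA : ∀ i j, A i j = A j i) (hA0 : ∀ i j, 0 ≤ A i j)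
    (hconn : ∀ i j : Fin N, Relation.ReflTransGen (fun p q : Fin N => 0 < A p q) i j)
    (hs : 0 < s) (hB : ∀ j y, 0 ≤ ⟪B j y, y⟫) (hBs : ∀ y, y ≠ 0 → 0 < ∑ j, ⟪B j y, y⟫)
    (x : PiLp 2 (fun _ : Fin N => G)) (hx : x ≠ 0) : 0 < ⟪networkOp B A s x, x⟫ := by
  refine (inner_networkOp_self_nonneg hA hA0 hs.le hB x).lt_of_ne' fun h0 => hx ?_
  rw [inner_networkOp hA] at h0
  have hterm : ∀ j l, 0 ≤ A j l * ⟪x j - x l, x j - x l⟫ := fun j l =>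
    mul_nonneg (hA0 _ _) real_inner_self_nonneg
  have hsum : 0 ≤ ∑ j, ∑ l, A j l * ⟪x j - x l, x j - x l⟫ :=
    Finset.sum_nonneg fun j _ => Finset.sum_nonneg fun l _ => hterm j l
  have hdiag : 0 ≤ ∑ j, ⟪B j (x j), x j⟫ := Finset.sum_nonneg fun j _ => hB j _
  have h1 : ∑ j, ∑ l, A j l * ⟪x j - x l, x j - x l⟫ = 0 := by
    nlinarith
  have h2 : ∑ j, ⟪B j (x j), x j⟫ = 0 := by
    rw [h1] at h0
    linarith
  have hadj : ∀ p q, 0 < A p q → x p = x q := fun p q hpq => by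
    have h3 := (Finset.sum_eq_zero_iff_of_nonneg fun j _ =>
      Finset.sum_nonneg fun l _ => hterm j l).1 h1 p (Finset.mem_univ _)
    have h4 := (Finset.sum_eq_zero_iff_of_nonneg fun l _ => hterm p l).1 h3 q (Finset.mem_univ _)
    have h5 := (mul_eq_zero.1 h4).resolve_left hpq.ne'
    exact sub_eq_zero.1 (inner_self_eq_zero.1 h5)
  have heq : ∀ p q, x p = x q := fun p q => by
    induction hconn p q with
    | refl => rfl
    | tail _ h ih => exact ih.trans (hadj _ _ h)
  ext i
  by_contra hi
  have h6 := hBs (x i) hi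
  rw [← h2] at h6
  exact h6.ne (Finset.sum_congr rfl fun j _ => by rw [heq j i])

lemma norm_networkOp_le {c : ℝ} (hc : 0 ≤ c) (hA0 : ∀ i j, 0 ≤ A i j) (hs : 0 ≤ s)
    (hB : ∀ j y, ‖B j y‖ ≤ c * ‖y‖) (x : PiLp 2 (fun _ : Fin N => G)) :
    ‖networkOp B A s x‖ ≤ (c + s * (2 * ∑ j, ∑ l, A j l)) * ‖x‖ := by
  let d : PiLp 2 (fun _ : Fin N => G) := WithLp.toLp 2 fun j => B j (x j)
  let L : PiLp 2 (fun _ : Fin N => G) := WithLp.toLp 2 fun j => ∑ l, A j l • (x j - x l)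
  have h0 : networkOp B A s x = d + s • L := rfl
  have hd : ‖d‖ ≤ c * ‖x‖ := by
    refine (sq_le_sq₀ (norm_nonneg _) (by positivity)).1 ?_
    rw [mul_pow, PiLp.norm_sq_eq_of_L2, PiLp.norm_sq_eq_of_L2, Finset.mul_sum]
    refine Finset.sum_le_sum fun j _ => ?_
    rw [← mul_pow]
    exact pow_le_pow_left₀ (norm_nonneg _) (hB j _) 2
  have hL : ‖L‖ ≤ (2 * ∑ j, ∑ l, A j l) * ‖x‖ := by
    have h1 : ∀ j, ‖L j‖ ≤ ∑ l, A j l * (2 * ‖x‖) := fun j => by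
      refine (norm_sum_le Finset.univ fun l => A j l • (x j - x l)).trans
        (Finset.sum_le_sum fun l _ => ?_)
      rw [norm_smul, Real.norm_of_nonneg (hA0 _ _)]
      refine mul_le_mul_of_nonneg_left ((norm_sub_le _ _).trans ?_) (hA0 _ _)
      linarith [PiLp.norm_apply_le x j, PiLp.norm_apply_le x l]
    have h2 : ‖L‖ ≤ ∑ j, ‖L j‖ := by
      refine (sq_le_sq₀ (norm_nonneg _) (Finset.sum_nonneg fun j _ => norm_nonneg _)).1 ?_
      rw [PiLp.norm_sq_eq_of_L2]
      exact Finset.sum_sq_le_sq_sum_of_nonneg fun j _ => norm_nonneg _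
    refine h2.trans ((Finset.sum_le_sum fun j _ => h1 j).trans (le_of_eq ?_))
    simp only [← Finset.sum_mul]
    ring
  rw [h0]
  refine (norm_add_le _ _).trans ?_
  rw [norm_smul, Real.norm_of_nonneg hs, add_mul, mul_assoc s]
  gcongr

end networkOp

lemma generateFrom_image2_inter {Ω : Type*} (m₁ m₂ : MeasurableSpace Ω) :
    m₁ ⊔ m₂ = MeasurableSpace.generateFrom
      (Set.image2 (· ∩ ·) {s | MeasurableSet[m₁] s} {s | MeasurableSet[m₂] s}) := by
  refine le_antisymm (sup_le (fun s hs => ?_) fun s hs => ?_)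
    (MeasurableSpace.generateFrom_le ?_)
  · exact MeasurableSpace.measurableSet_generateFrom
      ⟨s, hs, Set.univ, MeasurableSet.univ, Set.inter_univ s⟩
  · exact MeasurableSpace.measurableSet_generateFrom
      ⟨Set.univ, MeasurableSet.univ, s, hs, Set.univ_inter s⟩
  · rintro _ ⟨s, hs, t, ht, rfl⟩
    exact MeasurableSet.inter ((le_sup_left : m₁ ≤ m₁ ⊔ m₂) s hs)
      ((le_sup_right : m₂ ≤ m₁ ⊔ m₂) t ht)

lemma isPiSystem_image2_inter {Ω : Type*} (m₁ m₂ : MeasurableSpace Ω) :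
    IsPiSystem (Set.image2 (· ∩ ·) {s | MeasurableSet[m₁] s} {s | MeasurableSet[m₂] s}) := by
  rintro _ ⟨s, hs, t, ht, rfl⟩ _ ⟨u, hu, w, hw, rfl⟩ -
  exact ⟨s ∩ u, MeasurableSet.inter hs hu, t ∩ w, MeasurableSet.inter ht hw,
    Set.inter_inter_inter_comm s u t w⟩

/-- Adjoining a σ-algebra independent of `m₂` and `w` does not change the vanishing of the
conditional expectation of `w` given a sub-σ-algebra of `m₂`. -/
lemma condExp_sup_eq_zero_of_indep_s6 {Ω : Type*} {m₁ m₂ m₃ m0 : MeasurableSpace Ω} {P : Measure Ω}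
    [IsProbabilityMeasure P] (hm₁ : m₁ ≤ m0) (hm₂ : m₂ ≤ m0) (h32 : m₃ ≤ m₂)
    (hind : Indep m₁ m₂ P) {w : Ω → ℝ} (hw : StronglyMeasurable[m₂] w) (hwi : Integrable w P)
    (hw0 : P[w | m₃] =ᵐ[P] 0) : P[w | m₁ ⊔ m₃] =ᵐ[P] 0 := by
  have hm₃ : m₃ ≤ m0 := h32.trans hm₂
  have hsup : m₁ ⊔ m₃ ≤ m0 := sup_le hm₁ hm₃
  have key : ∀ s, MeasurableSet[m₁ ⊔ m₃] s → ∫ ω in s, w ω ∂P = 0 := by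
    intro s hs
    induction s, hs using MeasurableSpace.induction_on_inter (generateFrom_image2_inter m₁ m₃)
      (isPiSystem_image2_inter m₁ m₃) with
    | empty => simp
    | basic t ht =>
      obtain ⟨A, hA, B, hB, rfl⟩ := ht
      have h1 : ∫ ω in B, w ω ∂P = 0 := by
        rw [← setIntegral_condExp hm₃ hwi hB, integral_congr_ae (ae_restrict_of_ae hw0)]
        simp
      have h2 : P[B.indicator w | m₁] =ᵐ[P] fun _ => ∫ ω, B.indicator w ω ∂P :=
        condExp_indep_eq hm₂ hm₁ (hw.indicator (h32 _ hB)) hind.symm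
      have h3 := setIntegral_condExp hm₁ (hwi.indicator (hm₃ _ hB)) hA
      rw [integral_congr_ae (ae_restrict_of_ae h2), integral_indicator (hm₃ _ hB), h1,
        setIntegral_indicator (hm₃ _ hB)] at h3
      simpa using h3.symm
    | compl t ht ih =>
      have h1 := integral_add_compl (hsup _ ht) hwi
      have h2 : ∫ ω, w ω ∂P = 0 := by
        rw [← integral_condExp hm₃, integral_congr_ae hw0]
        simp
      linarith
    | iUnion f hd hf ih =>
      rw [integral_iUnion (fun i => hsup _ (hf i)) hd hwi.integrableOn]
      simp [ih]
  refine (ae_eq_condExp_of_forall_setIntegral_eq hsup hwi (fun s _ _ => ?_) (fun s hs _ => ?_)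
    aestronglyMeasurable_zero).symm
  · exact integrableOn_zero
  · rw [key s hs]
    simp

lemma ae_summable_of_summable_integral {Ω : Type*} {m0 : MeasurableSpace Ω} {P : Measure Ω}
    {q : ℕ → Ω → ℝ} (hq0 : ∀ k ω, 0 ≤ q k ω) (hqi : ∀ k, Integrable (q k) P)
    (hqs : Summable fun k => ∫ ω, q k ω ∂P) : ∀ᵐ ω ∂P, Summable fun k => q k ω := by
  have hm : ∀ k, AEMeasurable (fun ω => ENNReal.ofReal (q k ω)) P := fun k =>
    (hqi k).aestronglyMeasurable.aemeasurable.ennreal_ofReal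
  have h1 : ∫⁻ ω, ∑' k, ENNReal.ofReal (q k ω) ∂P ≠ ⊤ := by
    rw [lintegral_tsum hm]
    have h2 : ∀ k, ∫⁻ ω, ENNReal.ofReal (q k ω) ∂P = ENNReal.ofReal (∫ ω, q k ω ∂P) := fun k =>
      (ofReal_integral_eq_lintegral_ofReal (hqi k) (ae_of_all _ (hq0 k))).symm
    simp only [h2]
    rw [← ENNReal.ofReal_tsum_of_nonneg (fun k => integral_nonneg (hq0 k)) hqs]
    exact ENNReal.ofReal_ne_top
  filter_upwards [ae_lt_top' (AEMeasurable.tsum hm) h1] with ω hω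
  have h3 := ENNReal.summable_toReal hω.ne
  simpa [ENNReal.toReal_ofReal (hq0 _ ω)] using h3

/-- A Robbins–Siegmund type statement: a nonnegative adapted process which decreases up to
martingale differences and errors of summable expectation is bounded in mean and converges almost
surely. -/
lemma exists_integral_le_and_ae_tendsto {Ω : Type*} {m0 : MeasurableSpace Ω} {P : Measure Ω}
    [IsProbabilityMeasure P] (𝒢 : Filtration ℕ m0) {V d q : ℕ → Ω → ℝ}
    (hV0 : ∀ k ω, 0 ≤ V k ω) (hVm : ∀ k, StronglyMeasurable[𝒢 k] (V k))
    (hVi : ∀ k, Integrable (V k) P) (hdi : ∀ k, Integrable (d k) P)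
    (hd : ∀ k, P[d k | 𝒢 k] =ᵐ[P] 0)
    (hq0 : ∀ k ω, 0 ≤ q k ω) (hqm : ∀ k, StronglyMeasurable[𝒢 (k + 1)] (q k))
    (hqi : ∀ k, Integrable (q k) P) (hqs : Summable fun k => ∫ ω, q k ω ∂P)
    (hstep : ∀ k ω, V (k + 1) ω ≤ V k ω + d k ω + q k ω) :
    (∃ C, ∀ k, ∫ ω, V k ω ∂P ≤ C) ∧ ∀ᵐ ω ∂P, ∃ l, Tendsto (fun k => V k ω) atTop (nhds l) := by
  have hd0 : ∀ k, ∫ ω, d k ω ∂P = 0 := fun k => by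
    rw [← integral_condExp (𝒢.le k), integral_congr_ae (hd k)]
    simp
  have hbd : ∀ k, ∫ ω, V k ω ∂P ≤ ∫ ω, V 0 ω ∂P + ∑ j ∈ Finset.range k, ∫ ω, q j ω ∂P := by
    intro k
    induction k with
    | zero => simp
    | succ k ih =>
      have h1 := integral_mono (hVi (k + 1)) (((hVi k).add (hdi k)).add (hqi k)) (hstep k)
      have h2 := integral_add ((hVi k).add (hdi k)) (hqi k)
      have h3 := integral_add (hVi k) (hdi k)
      rw [Finset.sum_range_succ]
      simp only [Pi.add_apply] at h1 h2 h3
      linarith [hd0 k]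
  have hqsum : ∀ k, ∑ j ∈ Finset.range k, ∫ ω, q j ω ∂P ≤ ∑' j, ∫ ω, q j ω ∂P := fun k =>
    hqs.sum_le_tsum _ fun j _ => integral_nonneg (hq0 j)
  refine ⟨⟨_, fun k => (hbd k).trans (add_le_add le_rfl (hqsum k))⟩, ?_⟩
  let S : ℕ → Ω → ℝ := fun k ω => ∑ j ∈ Finset.range k, q j ω - V k ω
  have hsumi : ∀ k, Integrable (fun ω => ∑ j ∈ Finset.range k, q j ω) P := fun k =>
    integrable_finsetSum _ fun j _ => hqi j
  have hSi : ∀ k, Integrable (S k) P := fun k => (hsumi k).sub (hVi k)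
  have hSm : StronglyAdapted 𝒢 S := fun k => by
    refine StronglyMeasurable.sub ?_ (hVm k)
    exact Finset.stronglyMeasurable_fun_sum _ fun j hj =>
      (hqm j).mono (𝒢.mono (Finset.mem_range.1 hj))
  have hS : Submartingale S 𝒢 P := by
    refine submartingale_of_condExp_sub_nonneg_nat hSm hSi fun k => ?_
    have h1 : P[-d k | 𝒢 k] ≤ᵐ[P] P[S (k + 1) - S k | 𝒢 k] := by
      refine condExp_mono (hdi k).neg ((hSi _).sub (hSi _)) (ae_of_all _ fun ω => ?_)
      simp only [S, Pi.neg_apply, Pi.sub_apply, Finset.sum_range_succ]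
      linarith [hstep k ω]
    filter_upwards [h1, condExp_neg (d k) (𝒢 k) (μ := P), hd k] with ω h2 h3 h4
    rw [h3, Pi.neg_apply, h4] at h2
    simpa using h2
  have hSb : ∀ k, eLpNorm (S k) 1 P
      ≤ (Real.toNNReal (∫ ω, V 0 ω ∂P + 2 * ∑' j, ∫ ω, q j ω ∂P) : ℝ≥0∞) := fun k => by
    rw [eLpNorm_one_eq_lintegral_enorm, ← ofReal_integral_norm_eq_lintegral_enorm (hSi k)]
    refine ENNReal.ofReal_le_ofReal ?_
    have h1 : ∫ ω, ‖S k ω‖ ∂P ≤ ∫ ω, (∑ j ∈ Finset.range k, q j ω + V k ω) ∂P := by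
      refine integral_mono (hSi k).norm ((hsumi k).add (hVi k)) fun ω => ?_
      refine (norm_sub_le _ _).trans (le_of_eq ?_)
      rw [Real.norm_of_nonneg (hV0 k ω),
        Real.norm_of_nonneg (Finset.sum_nonneg fun j _ => hq0 j ω)]
    rw [integral_add (hsumi k) (hVi k), integral_finsetSum _ fun j _ => hqi j] at h1
    linarith [hbd k, hqsum k]
  filter_upwards [hS.ae_tendsto_limitProcess hSb, ae_summable_of_summable_integral hq0 hqi hqs]
    with ω h1 h2
  refine ⟨_, (h2.hasSum.tendsto_sum_nat.sub h1).congr fun k => ?_⟩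
  simp [S]

lemma countable_of_orthonormal {ι G : Type*} [NormedAddCommGroup G] [InnerProductSpace ℝ G]
    [TopologicalSpace.SeparableSpace G] {b : ι → G} (hb : Orthonormal ℝ b) : Countable ι := by
  have hd : Pairwise fun i j => Disjoint (Metric.ball (b i) (1 / 2)) (Metric.ball (b j) (1 / 2)) :=
    fun i j hij => by
      refine Metric.ball_disjoint_ball ?_
      have h1 : ‖b i - b j‖ ^ 2 = 2 := by
        rw [norm_sub_sq_real, hb.2 hij, hb.1, hb.1]
        norm_num
      rw [dist_eq_norm]
      nlinarith [norm_nonneg (b i - b j)]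
  exact hd.countable_of_isOpen_disjoint (fun _ => Metric.isOpen_ball)
    fun i => ⟨b i, Metric.mem_ball_self (by norm_num)⟩

/-- A function into a Hilbert space with separable range is strongly measurable as soon as its
inner products with all vectors are measurable. -/
lemma stronglyMeasurable_of_measurable_inner {Ω G : Type*} {m : MeasurableSpace Ω}
    [NormedAddCommGroup G] [InnerProductSpace ℝ G] [CompleteSpace G] {X : Ω → G}
    (hsep : TopologicalSpace.IsSeparable (Set.range X))
    (hX : ∀ g : G, Measurable fun ω => ⟪g, X ω⟫) : StronglyMeasurable X := by
  let U : Submodule ℝ G := (Submodule.span ℝ (Set.range X)).topologicalClosure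
  have hUsep : TopologicalSpace.IsSeparable (U : Set G) := hsep.span.closure
  have hUc : IsClosed (U : Set G) := Submodule.isClosed_topologicalClosure _
  have : CompleteSpace U := hUc.completeSpace_coe
  have : TopologicalSpace.SeparableSpace U := hUsep.separableSpace
  obtain ⟨w, b, hb⟩ := exists_hilbertBasis ℝ U
  have hw : Countable w := countable_of_orthonormal b.orthonormal
  have hmem : ∀ ω, X ω ∈ U := fun ω =>
    Submodule.le_topologicalClosure _ (Submodule.subset_span ⟨ω, rfl⟩)
  refine stronglyMeasurable_of_tendsto (atTop : Filter (Finset w))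
    (f := fun s ω => ∑ i ∈ s, ⟪(b i : G), X ω⟫ • (b i : G)) (fun s => ?_) ?_
  · exact Finset.stronglyMeasurable_fun_sum _ fun i _ =>
      (hX _).stronglyMeasurable.smul stronglyMeasurable_const
  · refine tendsto_pi_nhds.2 fun ω => ?_
    have h1 : HasSum (fun i => b.repr ⟨X ω, hmem ω⟩ i • b i) ⟨X ω, hmem ω⟩ := b.hasSum_repr _
    have h2 := h1.mapL U.subtypeL
    simpa [HasSum, b.repr_apply_apply] using h2

lemma not_summable_comp_mul_of_antitone {a : ℕ → ℝ} (ha : Antitone a) (ha0 : ∀ k, 0 ≤ a k)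
    (hs : ¬ Summable a) {h : ℕ} (hh : 0 < h) : ¬ Summable fun k => a (k * h) := fun hsum => by
  refine hs (summable_of_sum_range_le (c := h * ∑' k, a (k * h)) ha0 fun n => ?_)
  have h1 : ∀ n, ∑ i ∈ Finset.range (n * h), a i ≤ h * ∑ k ∈ Finset.range n, a (k * h) := by
    intro n
    induction n with
    | zero => simp
    | succ n ih =>
      rw [add_mul, one_mul, Finset.sum_range_add, Finset.sum_range_succ, mul_add]
      refine add_le_add ih ?_
      refine (Finset.sum_le_card_nsmul _ _ (a (n * h)) fun i _ => ha (Nat.le_add_right _ _)).trans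
        (le_of_eq ?_)
      rw [Finset.card_range, nsmul_eq_mul]
  calc ∑ i ∈ Finset.range n, a i ≤ ∑ i ∈ Finset.range (n * h), a i :=
        Finset.sum_le_sum_of_subset_of_nonneg
          (Finset.range_mono (Nat.le_mul_of_pos_right n hh)) fun i _ _ => ha0 i
    _ ≤ h * ∑ k ∈ Finset.range n, a (k * h) := h1 n
    _ ≤ h * ∑' k, a (k * h) := by
      gcongr
      exact hsum.sum_le_tsum _ fun i _ => ha0 _

lemma norm_sub_le_of_norm_succ_sub_le {G : Type*} [SeminormedAddCommGroup G] {x : ℕ → G} {C : ℝ}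
    {n : ℕ} (hx : ∀ i, n ≤ i → ‖x (i + 1) - x i‖ ≤ C) (l : ℕ) :
    ‖x (n + l) - x n‖ ≤ l * C := by
  induction l with
  | zero => simp
  | succ l ih =>
    have h1 : x (n + (l + 1)) - x n = (x (n + l + 1) - x (n + l)) + (x (n + l) - x n) := by
      rw [← add_assoc]
      abel
    rw [h1]
    refine (norm_add_le _ _).trans ?_
    push_cast
    linarith [hx (n + l) (Nat.le_add_right _ _)]

/-- Gains which are comparable up to `a² + b²` vary by at most a multiple of `(a n + b n)²` on the
block `[n, n + h)`. -/
lemma abs_gain_sub_le {a b : ℕ → ℝ} (ha_pos : ∀ k, 0 < a k) (hb_pos : ∀ k, 0 < b k)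
    (ha : Antitone a) (hb : Antitone b) {C : ℝ} (hC : 0 < C)
    (hab : ∀ k, max (a k - a (k + 1)) |b k - a k| ≤ C * (a k ^ 2 + b k ^ 2))
    {n i h : ℕ} (hni : n ≤ i) (hih : i < n + h) :
    |a i - a n| ≤ C * (h + 1) * (a n + b n) ^ 2 ∧ |b i - a n| ≤ C * (h + 1) * (a n + b n) ^ 2 := by
  have hsq : ∀ i, n ≤ i → a i ^ 2 + b i ^ 2 ≤ (a n + b n) ^ 2 := fun i hi => by
    have h1 := pow_le_pow_left₀ (ha_pos i).le (ha hi) 2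
    have h2 := pow_le_pow_left₀ (hb_pos i).le (hb hi) 2
    nlinarith [ha_pos n, hb_pos n, mul_pos (ha_pos n) (hb_pos n)]
  obtain ⟨l, rfl⟩ := Nat.exists_eq_add_of_le hni
  have h1 : ‖a (n + l) - a n‖ ≤ l * (C * (a n + b n) ^ 2) := by
    refine norm_sub_le_of_norm_succ_sub_le (fun i hi => ?_) l
    rw [norm_sub_rev, Real.norm_of_nonneg (sub_nonneg.2 (ha (Nat.le_succ i)))]
    exact ((le_max_left _ _).trans (hab i)).trans (by gcongr; exact hsq i hi)
  have h2 : |b (n + l) - a (n + l)| ≤ C * (a n + b n) ^ 2 :=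
    ((le_max_right _ _).trans (hab _)).trans (by gcongr; exact hsq _ hni)
  rw [Real.norm_eq_abs] at h1
  have hl : (l : ℝ) ≤ h := by exact_mod_cast (show l ≤ h by lia)
  have h3 : (l : ℝ) * (C * (a n + b n) ^ 2) ≤ h * (C * (a n + b n) ^ 2) := by gcongr
  have h4 : 0 ≤ C * (a n + b n) ^ 2 := by positivity
  have h5 := abs_sub_le (b (n + l)) (a (n + l)) (a n)
  constructor <;> linarith

lemma norm_le_of_orthogonal {G : Type*} [NormedAddCommGroup G] [InnerProductSpace ℝ G] {y z : G}
    (hyz : ⟪y, z - y⟫ = 0) : ‖y‖ ≤ ‖z‖ := by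
  rw [inner_sub_right, real_inner_self_eq_norm_sq, sub_eq_zero] at hyz
  have h1 := real_inner_le_norm y z
  rcases (norm_nonneg y).eq_or_lt with h0 | h0
  · rw [← h0]
    exact norm_nonneg z
  · nlinarith

lemma norm_toLp_two_le_sum {N : ℕ} {G : Type*} [NormedAddCommGroup G] [InnerProductSpace ℝ G]
    (x : PiLp 2 (fun _ : Fin N => G)) : ‖x‖ ≤ ∑ j, ‖x j‖ := by
  refine (sq_le_sq₀ (norm_nonneg _) (Finset.sum_nonneg fun j _ => norm_nonneg _)).1 ?_
  rw [PiLp.norm_sq_eq_of_L2]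
  exact Finset.sum_sq_le_sq_sum_of_nonneg fun j _ => norm_nonneg _

/-- Convergence of the decentralized recursion in a Hilbert space `G` (in the application,
`G = L²(Ω; H_K)`), where `W k` collects the vectors known at time `k`, and `Y j k` plays the role of
the conditional expectation of `∑ H_j(i) E_j(kh)` over the `k`-th block. -/
theorem tendsto_zero_of_network_recursion {G : Type*} [NormedAddCommGroup G]
    [InnerProductSpace ℝ G] [CompleteSpace G] {N : ℕ} {A : Fin N → Fin N → ℝ}
    (hA_symm : ∀ i j, A i j = A j i) (hA_nonneg : ∀ i j, 0 ≤ A i j)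
    (hconn : ∀ i j : Fin N, Relation.ReflTransGen (fun p q : Fin N => 0 < A p q) i j)
    {a b : ℕ → ℝ} (ha_pos : ∀ k, 0 < a k) (hb_pos : ∀ k, 0 < b k)
    (ha : Antitone a) (hb : Antitone b)
    (hsa : Summable fun k => a k ^ 2) (hsb : Summable fun k => b k ^ 2) (hna : ¬ Summable a)
    {C : ℝ} (hC : 0 < C)
    (hab : ∀ k, max (a k - a (k + 1)) |b k - a k| ≤ C * (a k ^ 2 + b k ^ 2))
    {E w : Fin N → ℕ → G} {H : Fin N → ℕ → G →ₗ[ℝ] G} {κ B D : ℝ}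
    (hκ : 0 ≤ κ) (hB : 0 ≤ B) (hD : 0 ≤ D)
    (hH : ∀ j k x, ‖H j k x‖ ≤ κ * ‖x‖) (hw : ∀ j k, ‖w j k‖ ≤ B) (hE : ∀ j k, ‖E j k‖ ≤ D)
    (hstep : ∀ j k, E j (k + 1) = E j k - a k • H j k (E j k) + a k • w j k
      + b k • ∑ l, A j l • (E l k - E j k))
    (W : ℕ → Submodule ℝ G) (hW : Monotone W) (hHW : ∀ j k, ∀ x ∈ W (k + 1), H j k x ∈ W (k + 1))
    (hEW : ∀ j k, E j k ∈ W k)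
    (hwW : ∀ j k, w j k ∈ W (k + 1)) (hwo : ∀ j k, ∀ x ∈ W k, ⟪x, w j k⟫ = 0)
    {Nop : Fin N → G →ₗ[ℝ] G} (hNs : ∀ j, (Nop j).IsSymmetric) (hNp : ∀ j x, 0 ≤ ⟪Nop j x, x⟫)
    (hNpos : ∀ x, x ≠ 0 → 0 < ∑ j, ⟪Nop j x, x⟫) {cN : ℝ} (hcN : 0 < cN)
    (hNb : ∀ j x, ‖Nop j x‖ ≤ cN * ‖x‖) (hNW : ∀ j k, ∀ x ∈ W k, Nop j x ∈ W k)
    {h : ℕ} (hh : 0 < h) {Y : Fin N → ℕ → G} (hYW : ∀ j k, Y j k ∈ W (k * h))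
    (hYo : ∀ j k, ∀ x ∈ W (k * h),
      ⟪x, ∑ i ∈ Finset.Ico (k * h) ((k + 1) * h), H j i (E j (k * h)) - Y j k⟫ = 0)
    (hYs : ∀ j, Summable fun k => ‖Nop j (E j (k * h)) - Y j k‖ ^ 2) (j : Fin N) :
    Tendsto (E j) atTop (nhds 0) := by
  set γ : ℕ → ℝ := fun n => a n + b n with hγ
  have hγ0 : ∀ n, 0 < γ n := fun n => add_pos (ha_pos n) (hb_pos n)
  have hγs : Summable fun n => γ n ^ 2 := by
    refine Summable.of_nonneg_of_le (fun n => sq_nonneg _) (fun n => ?_)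
      ((hsa.add hsb).mul_left 2)
    simp only [hγ]
    nlinarith [sq_nonneg (a n - b n)]
  have hγh : Summable fun k => γ (k * h) ^ 2 :=
    hγs.comp_injective (i := fun k => k * h) fun k l hkl => Nat.eq_of_mul_eq_mul_right hh hkl
  set SA : ℝ := ∑ j, ∑ l, A j l with hSA
  have hSA0 : 0 ≤ SA := Finset.sum_nonneg fun j _ => Finset.sum_nonneg fun l _ => hA_nonneg _ _
  have hSAj : ∀ j, ∑ l, A j l ≤ SA := fun j =>
    Finset.single_le_sum (f := fun j => ∑ l, A j l)
      (fun j _ => Finset.sum_nonneg fun l _ => hA_nonneg _ _) (Finset.mem_univ j)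
  have hlap : ∀ (j : Fin N) (x : Fin N → G) (M : ℝ), 0 ≤ M → (∀ l, ‖x l‖ ≤ M) →
      ‖∑ l, A j l • (x l - x j)‖ ≤ 2 * M * SA := fun j x M hM hx => by
    have h1 : ∀ l, ‖A j l • (x l - x j)‖ ≤ A j l * (2 * M) := fun l => by
      rw [norm_smul, Real.norm_of_nonneg (hA_nonneg _ _)]
      exact mul_le_mul_of_nonneg_left ((norm_sub_le _ _).trans (by linarith [hx l, hx j]))
        (hA_nonneg _ _)
    refine (norm_sum_le _ _).trans ((Finset.sum_le_sum fun l _ => h1 l).trans ?_)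
    rw [← Finset.sum_mul, mul_comm]
    exact mul_le_mul_of_nonneg_left (hSAj j) (by positivity)
  set C₁ : ℝ := κ * D + B + 2 * D * SA with hC₁
  have hC₁0 : 0 ≤ C₁ := by positivity
  have hinc : ∀ j n i, n ≤ i → ‖E j (i + 1) - E j i‖ ≤ C₁ * γ n := fun j n i hni => by
    have h1 : E j (i + 1) - E j i = -(a i • H j i (E j i)) + a i • w j i
        + b i • ∑ l, A j l • (E l i - E j i) := by rw [hstep]; abel
    have h2 : ‖H j i (E j i)‖ ≤ κ * D := (hH j i _).trans (by gcongr; exact hE j i)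
    have h3 := hlap j (fun l => E l i) D hD fun l => hE l i
    rw [h1]
    refine (norm_add₃_le).trans ?_
    rw [norm_neg, norm_smul, norm_smul, norm_smul, Real.norm_of_nonneg (ha_pos i).le,
      Real.norm_of_nonneg (hb_pos i).le]
    have ha1 : a i ≤ γ n := by linarith [ha hni, hb_pos n, show γ n = a n + b n from rfl]
    have hb1 : b i ≤ γ n := by linarith [hb hni, ha_pos n, show γ n = a n + b n from rfl]
    have e1 := mul_le_mul ha1 h2 (norm_nonneg _) (hγ0 n).le
    have e2 := mul_le_mul ha1 (hw j i) (norm_nonneg _) (hγ0 n).le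
    have e3 := mul_le_mul hb1 h3 (norm_nonneg _) (hγ0 n).le
    rw [hC₁]
    linarith
  have hdist : ∀ j n i, n ≤ i → i < n + h → ‖E j i - E j n‖ ≤ h * (C₁ * γ n) :=
    fun j n i hni hih => by
      obtain ⟨l, rfl⟩ := Nat.exists_eq_add_of_le hni
      refine (norm_sub_le_of_norm_succ_sub_le (fun i hi => hinc j n i hi) l).trans ?_
      have : (l : ℝ) ≤ h := by exact_mod_cast (show l ≤ h by lia)
      have := hγ0 n
      gcongr
  set T := networkOp Nop A (h : ℝ) with hT
  set Z : ℕ → PiLp 2 (fun _ : Fin N => G) := fun k => WithLp.toLp 2 fun j => E j (k * h) with hZ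
  set I : ℕ → Finset ℕ := fun k => Finset.Ico (k * h) ((k + 1) * h) with hI
  have hIcard : ∀ k, ((I k).card : ℝ) = h := fun k => by
    simp [hI, Nat.card_Ico, add_mul]
  have hImem : ∀ k i, i ∈ I k → k * h ≤ i ∧ i < k * h + h := fun k i hi => by
    simpa [hI, add_mul] using hi
  set μ : ℕ → PiLp 2 (fun _ : Fin N => G) := fun k => WithLp.toLp 2 fun j =>
    -(a (k * h) • (∑ i ∈ I k, H j i (E j (k * h)) - Y j k)) + ∑ i ∈ I k, a i • w j i with hμdef
  set r : ℕ → PiLp 2 (fun _ : Fin N => G) := fun k =>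
    Z (k + 1) - Z k + a (k * h) • T (Z k) - μ k with hrdef
  have hsumle : ∀ (k : ℕ) (F : ℕ → G) (M : ℝ), (∀ i ∈ I k, ‖F i‖ ≤ M) →
      ‖∑ i ∈ I k, F i‖ ≤ h * M := fun k F M hF => by
    refine (norm_sum_le_of_le _ hF).trans (le_of_eq ?_)
    rw [Finset.sum_const, nsmul_eq_mul, hIcard]
  have hμn : ∀ k j, ‖μ k j‖ ≤ (2 * (h * (κ * D)) + h * B) * γ (k * h) := fun k j => by
    have h1 : ‖∑ i ∈ I k, H j i (E j (k * h))‖ ≤ h * (κ * D) :=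
      hsumle k _ _ fun i _ => (hH j i _).trans (by gcongr; exact hE j _)
    have h2 : ‖Y j k‖ ≤ ‖∑ i ∈ I k, H j i (E j (k * h))‖ :=
      norm_le_of_orthogonal (hYo j k _ (hYW j k))
    have h3 : ‖∑ i ∈ I k, a i • w j i‖ ≤ h * (γ (k * h) * B) := hsumle k _ _ fun i hi => by
      rw [norm_smul, Real.norm_of_nonneg (ha_pos i).le]
      have := ha (hImem k i hi).1
      exact mul_le_mul (by linarith [hb_pos (k * h), show γ (k * h) = a (k * h) + b (k * h) from rfl])
        (hw j i) (norm_nonneg _) (hγ0 _).le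
    have h4 : a (k * h) ≤ γ (k * h) := le_add_of_nonneg_right (hb_pos _).le
    have h5 : ‖a (k * h) • (∑ i ∈ I k, H j i (E j (k * h)) - Y j k)‖
        ≤ γ (k * h) * (2 * (h * (κ * D))) := by
      rw [norm_smul, Real.norm_of_nonneg (ha_pos _).le]
      exact mul_le_mul h4 ((norm_sub_le _ _).trans (by linarith)) (norm_nonneg _) (hγ0 _).le
    refine (norm_add_le _ _).trans ?_
    rw [norm_neg]
    linarith
  have hrj : ∀ k j, r k j = ∑ i ∈ I k, ((a (k * h) - a i) • H j i (E j (k * h))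
        + a i • H j i (E j (k * h) - E j i)
        + ((b i - a (k * h)) • ∑ l, A j l • (E l i - E j i)
        + a (k * h) • ∑ l, A j l • ((E l i - E l (k * h)) - (E j i - E j (k * h)))))
      + a (k * h) • (Nop j (E j (k * h)) - Y j k) := fun k j => by
    have h1 : E j ((k + 1) * h) - E j (k * h) = ∑ i ∈ I k, (E j (i + 1) - E j i) :=
      (Finset.sum_Ico_sub (E j) (by gcongr; lia)).symm
    have h2 : (h : ℝ) • ∑ l, A j l • (E j (k * h) - E l (k * h))
        = ∑ i ∈ I k, ∑ l, A j l • (E j (k * h) - E l (k * h)) := by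
      rw [Finset.sum_const, ← hIcard k, Nat.cast_smul_eq_nsmul]
    have h3 : r k j = (E j ((k + 1) * h) - E j (k * h))
        + a (k * h) • (Nop j (E j (k * h)) + (h : ℝ) • ∑ l, A j l • (E j (k * h) - E l (k * h)))
        - (-(a (k * h) • (∑ i ∈ I k, H j i (E j (k * h)) - Y j k)) + ∑ i ∈ I k, a i • w j i) := rfl
    rw [h3, h1, h2]
    simp only [hstep, smul_add, smul_sub, sub_smul, map_sub, Finset.smul_sum,
      Finset.sum_add_distrib, Finset.sum_sub_distrib]
    abel
  set C₂ : ℝ := h * (C * (h + 1) * (κ * D) + κ * (h * C₁) + (C * (h + 1) * (2 * D * SA)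
    + 2 * (h * C₁) * SA)) with hC₂
  have hrn : ∀ k j, ‖r k j‖ ≤ (C₂ + 1) * γ (k * h) ^ 2 + ‖Nop j (E j (k * h)) - Y j k‖ ^ 2 := by
    intro k j
    have hg := hγ0 (k * h)
    have haγ : a (k * h) ≤ γ (k * h) := le_add_of_nonneg_right (hb_pos _).le
    have h1 : ‖∑ i ∈ I k, ((a (k * h) - a i) • H j i (E j (k * h))
        + a i • H j i (E j (k * h) - E j i)
        + ((b i - a (k * h)) • ∑ l, A j l • (E l i - E j i)
        + a (k * h) • ∑ l, A j l • ((E l i - E l (k * h)) - (E j i - E j (k * h)))))‖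
        ≤ h * ((C * (h + 1) * γ (k * h) ^ 2) * (κ * D) + γ (k * h) * (κ * (h * (C₁ * γ (k * h))))
          + ((C * (h + 1) * γ (k * h) ^ 2) * (2 * D * SA)
          + γ (k * h) * (2 * (h * (C₁ * γ (k * h))) * SA))) := by
      refine hsumle k _ _ fun i hi => ?_
      obtain ⟨hi1, hi2⟩ := hImem k i hi
      obtain ⟨g1, g2⟩ := abs_gain_sub_le ha_pos hb_pos ha hb hC hab hi1 hi2
      refine (norm_add_le _ _).trans (add_le_add ((norm_add_le _ _).trans (add_le_add ?_ ?_))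
        ((norm_add_le _ _).trans (add_le_add ?_ ?_)))
      · rw [norm_smul, norm_sub_rev]
        exact mul_le_mul g1 ((hH j i _).trans (by gcongr; exact hE j _)) (norm_nonneg _)
          (by positivity)
      · rw [norm_smul, Real.norm_of_nonneg (ha_pos i).le]
        refine mul_le_mul ((ha hi1).trans haγ) ((hH j i _).trans ?_) (norm_nonneg _) hg.le
        rw [norm_sub_rev]
        gcongr
        exact hdist j _ i hi1 hi2
      · rw [norm_smul]
        exact mul_le_mul g2 (hlap j (fun l => E l i) D hD fun l => hE l i) (norm_nonneg _)
          (by positivity)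
      · rw [norm_smul, Real.norm_of_nonneg (ha_pos _).le]
        exact mul_le_mul haγ (hlap j (fun l => E l i - E l (k * h)) _ (by positivity)
          fun l => hdist l _ i hi1 hi2) (norm_nonneg _) hg.le
    have h2 : ‖a (k * h) • (Nop j (E j (k * h)) - Y j k)‖
        ≤ γ (k * h) ^ 2 + ‖Nop j (E j (k * h)) - Y j k‖ ^ 2 := by
      rw [norm_smul, Real.norm_of_nonneg (ha_pos _).le]
      have := mul_le_mul_of_nonneg_right haγ (norm_nonneg (Nop j (E j (k * h)) - Y j k))
      nlinarith [sq_nonneg (γ (k * h) - ‖Nop j (E j (k * h)) - Y j k‖), sq_nonneg (γ (k * h)),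
        sq_nonneg ‖Nop j (E j (k * h)) - Y j k‖]
    rw [hrj]
    refine ((norm_add_le _ _).trans (add_le_add h1 h2)).trans (le_of_eq ?_)
    rw [hC₂]
    ring
  have hZ0 : Tendsto Z atTop (nhds 0) := by
    refine tendsto_zero_of_perturbed_recursion (T := T) (networkOp_isSymmetric hA_symm hNs)
      (inner_networkOp_self_pos hA_symm hA_nonneg hconn (by exact_mod_cast hh) hNp hNpos)
      (c := cN + h * (2 * SA)) (by positivity)
      (norm_networkOp_le hcN.le hA_nonneg (by positivity) hNb)
      (α := fun k => a (k * h)) (fun k => (ha_pos _).le) ?_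
      (not_summable_comp_mul_of_antitone ha (fun k => (ha_pos k).le) hna hh)
      (r := r) (μ := μ) (fun k => ?_) ?_ ?_
      (fun k => { carrier := {x | ∀ j, x j ∈ W (k * h)}
                  add_mem' := fun hx hy j => Submodule.add_mem _ (hx j) (hy j)
                  zero_mem' := fun j => Submodule.zero_mem _
                  smul_mem' := fun t x hx j => Submodule.smul_mem _ t (hx j) })
      ?_ ?_ ?_ ?_
    · have h1 : Tendsto (fun k => a (k * h) ^ 2) atTop (nhds 0) :=
        (hsa.comp_injective (i := fun k => k * h)
          fun k l hkl => Nat.eq_of_mul_eq_mul_right hh hkl).tendsto_atTop_zero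
      have h2 := h1.sqrt
      simpa [Real.sqrt_sq (ha_pos _).le] using h2
    · simp only [hrdef]
      abel
    · have h1 : Summable fun k => ∑ j, ((C₂ + 1) * γ (k * h) ^ 2
          + ‖Nop j (E j (k * h)) - Y j k‖ ^ 2) :=
        summable_sum fun j _ => (hγh.mul_left _).add (hYs j)
      exact Summable.of_nonneg_of_le (fun k => norm_nonneg _) (fun k =>
        (norm_toLp_two_le_sum _).trans (Finset.sum_le_sum fun j _ => hrn k j)) h1
    · have h1 : Summable fun k => ∑ _j : Fin N, ((2 * (h * (κ * D)) + h * B) ^ 2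
          * γ (k * h) ^ 2) := summable_sum fun j _ => hγh.mul_left _
      refine Summable.of_nonneg_of_le (fun k => sq_nonneg _) (fun k => ?_) h1
      rw [PiLp.norm_sq_eq_of_L2]
      refine Finset.sum_le_sum fun j _ => ?_
      rw [← mul_pow]
      exact pow_le_pow_left₀ (norm_nonneg _) (hμn k j) 2
    · exact fun k l hkl x hx j => hW (Nat.mul_le_mul_right h hkl) (hx j)
    · intro k x hx j
      refine Submodule.add_mem _ (hNW j _ _ (hx j)) (Submodule.smul_mem _ _
        (Submodule.sum_mem _ fun l _ => Submodule.smul_mem _ _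
          (Submodule.sub_mem _ (hx j) (hx l))))
    · intro k j
      have hle : ∀ i ∈ I k, W (i + 1) ≤ W ((k + 1) * h) := fun i hi =>
        hW (by have := hImem k i hi; rw [add_mul, one_mul]; lia)
      have hle0 : W (k * h) ≤ W ((k + 1) * h) := hW (Nat.mul_le_mul_right h (Nat.le_succ k))
      refine Submodule.add_mem _ (Submodule.neg_mem _ (Submodule.smul_mem _ _
        (Submodule.sub_mem _ (Submodule.sum_mem _ fun i hi => ?_) (hle0 (hYW j k)))))
        (Submodule.sum_mem _ fun i hi => Submodule.smul_mem _ _ (hle i hi (hwW j i)))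
      exact hle i hi (hHW j i _ (hW (show k * h ≤ i + 1 by have := hImem k i hi; lia) (hEW j _)))
    · intro k x hx
      rw [PiLp.inner_apply]
      refine Finset.sum_eq_zero fun j _ => ?_
      simp only [hμdef]
      rw [inner_add_right, inner_neg_right, real_inner_smul_right, hYo j k _ (hx j), inner_sum]
      simp only [mul_zero, neg_zero, zero_add]
      refine Finset.sum_eq_zero fun i hi => ?_
      rw [real_inner_smul_right, hwo j i _ (hW (hImem k i hi).1 (hx j)), mul_zero]
  have hdiv : Tendsto (fun i => i / h) atTop atTop := Nat.tendsto_div_const_atTop hh.ne'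
  have hγ0' : Tendsto (fun k => γ (k * h)) atTop (nhds 0) := by
    have h2 := hγh.tendsto_atTop_zero.sqrt
    simpa [Real.sqrt_sq (hγ0 _).le] using h2
  have hbound : Tendsto (fun k => ‖Z k‖ + h * (C₁ * γ (k * h))) atTop (nhds 0) := by
    have := hZ0.norm.add ((hγ0'.const_mul C₁).const_mul (h : ℝ))
    simpa using this
  refine squeeze_zero_norm (fun i => ?_) (hbound.comp hdiv)
  have h1 := hdist j (i / h * h) i (Nat.div_mul_le_self i h)
    (Nat.lt_div_mul_add hh)
  have h2 : ‖E j (i / h * h)‖ ≤ ‖Z (i / h)‖ := PiLp.norm_apply_le (Z (i / h)) j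
  have h3 := norm_add_le (E j (i / h * h)) (E j i - E j (i / h * h))
  rw [add_sub_cancel] at h3
  simp only [Function.comp_apply]
  linarith

lemma rankOne_apply {H : Type*} [NormedAddCommGroup H] [InnerProductSpace ℝ H] (φ ψ f : H) :
    rankOne φ ψ f = ⟪f, ψ⟫ • φ := by
  simp [rankOne, real_inner_comm]

lemma norm_rankOne_self_apply_le {H : Type*} [NormedAddCommGroup H] [InnerProductSpace ℝ H]
    {φ : H} {κ : ℝ} (hφ : ‖φ‖ ≤ κ) (f : H) : ‖rankOne φ φ f‖ ≤ κ ^ 2 * ‖f‖ := by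
  rw [rankOne_apply, norm_smul]
  calc ‖⟪f, φ⟫‖ * ‖φ‖ ≤ (‖f‖ * ‖φ‖) * ‖φ‖ := by gcongr; exact norm_inner_le_norm f φ
    _ = ‖φ‖ ^ 2 * ‖f‖ := by ring
    _ ≤ κ ^ 2 * ‖f‖ := by gcongr

/-- The error process of a decentralized least mean squares recursion with regressors `φ`, noises
`v`, gains `a`, `b` and network weights `A`. The filtration `𝓕` is generated by the past, and `𝒢`
contains in addition the present and future regressors. -/
structure IsNetworkErrorProcess {Ω : Type*} {m0 : MeasurableSpace Ω} (P : Measure Ω)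
    {H : Type*} [NormedAddCommGroup H] [InnerProductSpace ℝ H] {N : ℕ} (A : Fin N → Fin N → ℝ)
    (a b : ℕ → ℝ) (𝓕 𝒢 : Filtration ℕ m0) (φ : Fin N → ℕ → Ω → H) (v : Fin N → ℕ → Ω → ℝ)
    (κ β : ℝ) (e : Fin N → ℕ → Ω → H) : Prop where
  pos : 0 < κ
  norm_le : ∀ j k ω, ‖φ j k ω‖ ≤ κ
  le : ∀ k, 𝓕 k ≤ 𝒢 k
  regressor_past : ∀ j k, StronglyMeasurable[𝓕 (k + 1)] (φ j k)
  regressor : ∀ j k, StronglyMeasurable[𝒢 k] (φ j k)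
  noise_past : ∀ j k, StronglyMeasurable[𝓕 (k + 1)] (v j k)
  noise_memLp : ∀ j k, MemLp (v j k) 2 P
  integral_noise_sq_le : ∀ j k, ∫ ω, v j k ω ^ 2 ∂P ≤ β
  condExp_noise : ∀ j k, P[v j k | 𝒢 k] =ᵐ[P] 0
  init : ∀ j, ∃ c, ∀ ω, e j 0 ω = c
  step : ∀ j k ω, e j (k + 1) ω = e j k ω - a k • rankOne (φ j k ω) (φ j k ω) (e j k ω)
    + a k • (v j k ω • φ j k ω) + b k • ∑ l, A j l • (e l k ω - e j k ω)

namespace IsNetworkErrorProcess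

variable {Ω : Type*} {m0 : MeasurableSpace Ω} {P : Measure Ω}
  {H : Type*} [NormedAddCommGroup H] [InnerProductSpace ℝ H] {N : ℕ} {A : Fin N → Fin N → ℝ}
  {a b : ℕ → ℝ} {𝓕 𝒢 : Filtration ℕ m0} {φ : Fin N → ℕ → Ω → H} {v : Fin N → ℕ → Ω → ℝ}
  {κ β : ℝ} {e : Fin N → ℕ → Ω → H}

lemma stronglyMeasurable_rankOne_apply {m : MeasurableSpace Ω} {ψ g : Ω → H}
    (hψ : StronglyMeasurable[m] ψ) (hg : StronglyMeasurable[m] g) :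
    StronglyMeasurable[m] fun ω => rankOne (ψ ω) (ψ ω) (g ω) := by
  simp only [rankOne_apply]
  exact (hg.inner hψ).smul hψ

lemma memLp_rankOne_apply (he : IsNetworkErrorProcess P A a b 𝓕 𝒢 φ v κ β e) {g : Ω → H}
    (hg : MemLp g 2 P) (j : Fin N) (k : ℕ) :
    MemLp (fun ω => rankOne (φ j k ω) (φ j k ω) (g ω)) 2 P := by
  have hφ := ((he.regressor j k).mono (𝒢.le k)).aestronglyMeasurable (μ := P)
  refine MemLp.of_le_mul (c := κ ^ 2) hg ?_
    (.of_forall fun ω => norm_rankOne_self_apply_le (he.norm_le j k ω) (g ω))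
  simp only [rankOne_apply]
  exact (hg.1.inner hφ).smul hφ

lemma memLp_noise_smul (he : IsNetworkErrorProcess P A a b 𝓕 𝒢 φ v κ β e) (j : Fin N) (k : ℕ) :
    MemLp (fun ω => v j k ω • φ j k ω) 2 P := by
  refine MemLp.of_le_mul (c := κ) (he.noise_memLp j k) ((he.noise_memLp j k).1.smul
    ((he.regressor j k).mono (𝒢.le k)).aestronglyMeasurable) (.of_forall fun ω => ?_)
  rw [norm_smul, mul_comm]
  exact mul_le_mul_of_nonneg_right (he.norm_le j k ω) (norm_nonneg _)

lemma stronglyMeasurable (he : IsNetworkErrorProcess P A a b 𝓕 𝒢 φ v κ β e) (j : Fin N) (k : ℕ) :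
    StronglyMeasurable[𝓕 k] (e j k) := by
  induction k generalizing j with
  | zero =>
    obtain ⟨c, hc⟩ := he.init j
    rw [funext hc]
    exact stronglyMeasurable_const
  | succ k ih =>
    have ih' := fun l => (ih l).mono (𝓕.mono k.le_succ)
    rw [funext (he.step j k)]
    exact (((ih' j).sub ((stronglyMeasurable_rankOne_apply (he.regressor_past j k)
      (ih' j)).const_smul (a k))).add (((he.noise_past j k).smul
      (he.regressor_past j k)).const_smul (a k))).add
      ((Finset.stronglyMeasurable_fun_sum _ fun l _ =>
        ((ih' l).sub (ih' j)).const_smul (A j l)).const_smul (b k))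

lemma sum_norm_sq_step_le (he : IsNetworkErrorProcess P A a b 𝓕 𝒢 φ v κ β e)
    (hA_symm : ∀ i j, A i j = A j i) (hA_nonneg : ∀ i j, 0 ≤ A i j) {k : ℕ} (ha : 0 < a k)
    (hb : 0 < b k) (hk : a k * κ ^ 2 + b k * (2 * ∑ j, ∑ l, A j l) ≤ 1) (ω : Ω) :
    ∑ j, ‖e j (k + 1) ω‖ ^ 2 ≤ ∑ j, ‖e j k ω‖ ^ 2
      + ∑ j, 2 * a k * (⟪e j (k + 1) ω - a k • (v j k ω • φ j k ω), φ j k ω⟫ * v j k ω)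
      + ∑ j, a k ^ 2 * κ ^ 2 * v j k ω ^ 2 := by
  set x : PiLp 2 (fun _ : Fin N => H) := WithLp.toLp 2 fun j => e j k ω with hx
  set T := networkOp (fun j => (a k) • (rankOne (φ j k ω) (φ j k ω) : H →ₗ[ℝ] H)) A (b k) with hT
  have hin : ∀ j (y z : H), ⟪(a k • (rankOne (φ j k ω) (φ j k ω) : H →ₗ[ℝ] H)) y, z⟫
      = a k * (⟪y, φ j k ω⟫ * ⟪z, φ j k ω⟫) := fun j y z => by
    rw [LinearMap.smul_apply, ContinuousLinearMap.coe_coe, rankOne_apply, real_inner_smul_left,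
      real_inner_smul_left, real_inner_comm z]
  have hpos : ∀ j (y : H), 0 ≤ ⟪(a k • (rankOne (φ j k ω) (φ j k ω) : H →ₗ[ℝ] H)) y, y⟫ :=
    fun j y => by rw [hin]; exact mul_nonneg ha.le (mul_self_nonneg _)
  have hsymm : T.IsSymmetric := networkOp_isSymmetric hA_symm fun j y z => by
    have h1 := hin j z y
    rw [real_inner_comm] at h1
    rw [hin, h1, mul_comm ⟪y, φ j k ω⟫]
  have hc : 0 < a k * κ ^ 2 + b k * (2 * ∑ j, ∑ l, A j l) :=
    add_pos_of_pos_of_nonneg (mul_pos ha (pow_pos he.pos 2)) (mul_nonneg hb.le (mul_nonneg two_pos.le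
      (Finset.sum_nonneg fun _ _ => Finset.sum_nonneg fun _ _ => hA_nonneg _ _)))
  have hbound : ∀ y, ‖T y‖ ≤ (a k * κ ^ 2 + b k * (2 * ∑ j, ∑ l, A j l)) * ‖y‖ := fun y => by
    refine norm_networkOp_le (by have := he.pos; positivity) hA_nonneg hb.le (fun j z => ?_) y
    rw [LinearMap.smul_apply, norm_smul, Real.norm_of_nonneg ha.le, mul_assoc]
    exact mul_le_mul_of_nonneg_left (norm_rankOne_self_apply_le (he.norm_le j k ω) z) ha.le
  have hcontr := norm_sub_smul_le hsymm (inner_networkOp_self_nonneg hA_symm hA_nonneg hb.le hpos)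
    hc hbound zero_le_one (by rwa [one_mul]) x
  rw [one_smul] at hcontr
  have hcoord : ∀ j, (x - T x) j = e j (k + 1) ω - a k • (v j k ω • φ j k ω) := fun j => by
    have h1 : ∑ l, A j l • (e l k ω - e j k ω) = -∑ l, A j l • (e j k ω - e l k ω) := by
      rw [← Finset.sum_neg_distrib]
      exact Finset.sum_congr rfl fun l _ => by rw [← smul_neg, neg_sub]
    rw [PiLp.sub_apply, networkOp_apply, he.step, h1]
    simp only [hx, LinearMap.smul_apply, ContinuousLinearMap.coe_coe, smul_neg]
    abel
  have hsq : ∑ j, ‖e j (k + 1) ω - a k • (v j k ω • φ j k ω)‖ ^ 2 ≤ ∑ j, ‖e j k ω‖ ^ 2 := by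
    have h1 := pow_le_pow_left₀ (norm_nonneg _) hcontr 2
    rw [PiLp.norm_sq_eq_of_L2, PiLp.norm_sq_eq_of_L2] at h1
    simpa only [hcoord] using h1
  have hj : ∀ j, ‖e j (k + 1) ω‖ ^ 2 ≤ ‖e j (k + 1) ω - a k • (v j k ω • φ j k ω)‖ ^ 2
      + 2 * a k * (⟪e j (k + 1) ω - a k • (v j k ω • φ j k ω), φ j k ω⟫ * v j k ω)
      + a k ^ 2 * κ ^ 2 * v j k ω ^ 2 := fun j => by
    have h1 := norm_add_sq_real (e j (k + 1) ω - a k • (v j k ω • φ j k ω))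
      (a k • (v j k ω • φ j k ω))
    rw [sub_add_cancel, real_inner_smul_right, real_inner_smul_right] at h1
    have h2 : ‖a k • (v j k ω • φ j k ω)‖ ^ 2 ≤ a k ^ 2 * κ ^ 2 * v j k ω ^ 2 := by
      rw [norm_smul, norm_smul, mul_pow, mul_pow, Real.norm_eq_abs, Real.norm_eq_abs, sq_abs,
        sq_abs, mul_assoc, mul_comm (κ ^ 2)]
      gcongr
      exact he.norm_le j k ω
    linarith
  have := Finset.sum_le_sum fun j (_ : j ∈ Finset.univ) => hj j
  rw [Finset.sum_add_distrib, Finset.sum_add_distrib] at this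
  linarith

variable [IsProbabilityMeasure P]

lemma memLp (he : IsNetworkErrorProcess P A a b 𝓕 𝒢 φ v κ β e) (j : Fin N) (k : ℕ) :
    MemLp (e j k) 2 P := by
  induction k generalizing j with
  | zero =>
    obtain ⟨c, hc⟩ := he.init j
    rw [funext hc]
    exact memLp_const c
  | succ k ih =>
    rw [funext (he.step j k)]
    exact (((ih j).sub ((he.memLp_rankOne_apply (ih j) j k).const_smul (a k))).add
      ((he.memLp_noise_smul j k).const_smul (a k))).add
      ((memLp_finsetSum _ fun l _ => ((ih l).sub (ih j)).const_smul (A j l)).const_smul (b k))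

lemma exists_norm_bound_and_ae_tendsto (he : IsNetworkErrorProcess P A a b 𝓕 𝒢 φ v κ β e)
    (hA_symm : ∀ i j, A i j = A j i) (hA_nonneg : ∀ i j, 0 ≤ A i j)
    (ha_pos : ∀ k, 0 < a k) (hb_pos : ∀ k, 0 < b k)
    (hsa : Summable fun k => a k ^ 2) (hsb : Summable fun k => b k ^ 2) :
    (∃ D, ∀ j k, ∫ ω, ‖e j k ω‖ ^ 2 ∂P ≤ D) ∧
      ∀ᵐ ω ∂P, ∃ l, Tendsto (fun k => ∑ j, ‖e j k ω‖ ^ 2) atTop (nhds l) := by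
  have ha0 : Tendsto a atTop (nhds 0) := by
    simpa [Real.sqrt_sq (ha_pos _).le] using hsa.tendsto_atTop_zero.sqrt
  have hb0 : Tendsto b atTop (nhds 0) := by
    simpa [Real.sqrt_sq (hb_pos _).le] using hsb.tendsto_atTop_zero.sqrt
  have hlim : Tendsto (fun k => a k * κ ^ 2 + b k * (2 * ∑ j, ∑ l, A j l)) atTop (nhds 0) := by
    simpa using (ha0.mul_const (κ ^ 2)).add (hb0.mul_const (2 * ∑ j, ∑ l, A j l))
  obtain ⟨k₀, hk₀⟩ := eventually_atTop.1 (hlim.eventually (ge_mem_nhds zero_lt_one))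
  let 𝒢' : Filtration ℕ m0 :=
    ⟨fun k => 𝒢 (k + k₀), fun _ _ hkl => 𝒢.mono (Nat.add_le_add_right hkl k₀), fun k => 𝒢.le _⟩
  have hsm : ∀ j k, StronglyMeasurable[𝒢 k] (e j k) := fun j k =>
    (he.stronglyMeasurable j k).mono (he.le k)
  have hint : ∀ j k, Integrable (fun ω => ‖e j k ω‖ ^ 2) P := fun j k =>
    (he.memLp j k).integrable_norm_pow (by norm_num)
  have hy : ∀ j k, StronglyMeasurable[𝒢 k] fun ω =>
      ⟪e j (k + 1) ω - a k • (v j k ω • φ j k ω), φ j k ω⟫ := fun j k => by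
    have h1 : (fun ω => e j (k + 1) ω - a k • (v j k ω • φ j k ω)) = fun ω =>
        e j k ω - a k • rankOne (φ j k ω) (φ j k ω) (e j k ω)
          + b k • ∑ l, A j l • (e l k ω - e j k ω) := by
      funext ω
      rw [he.step]
      abel
    have h2 : StronglyMeasurable[𝒢 k] fun ω => e j (k + 1) ω - a k • (v j k ω • φ j k ω) := by
      rw [h1]
      exact ((hsm j k).sub ((stronglyMeasurable_rankOne_apply (he.regressor j k)
        (hsm j k)).const_smul (a k))).add ((Finset.stronglyMeasurable_fun_sum _ fun l _ =>
          ((hsm l k).sub (hsm j k)).const_smul (A j l)).const_smul (b k))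
    exact h2.inner (he.regressor j k)
  have hyv : ∀ j k, Integrable (fun ω =>
      ⟪e j (k + 1) ω - a k • (v j k ω • φ j k ω), φ j k ω⟫ * v j k ω) P := fun j k => by
    refine MemLp.integrable_mul (p := 2) (q := 2) ?_ (he.noise_memLp j k)
    refine MemLp.of_le_mul (c := κ)
      ((he.memLp j (k + 1)).sub ((he.memLp_noise_smul j k).const_smul (a k)))
      ((hy j k).mono (𝒢.le k)).aestronglyMeasurable (.of_forall fun ω => ?_)
    refine (norm_inner_le_norm _ _).trans ?_
    rw [mul_comm]
    exact mul_le_mul_of_nonneg_right (he.norm_le j k ω) (norm_nonneg _)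
  have hvi : ∀ j k, Integrable (fun ω => v j k ω ^ 2) P := fun j k =>
    (he.noise_memLp j k).integrable_sq
  have hd : ∀ j k, P[fun ω => 2 * a k *
      (⟪e j (k + 1) ω - a k • (v j k ω • φ j k ω), φ j k ω⟫ * v j k ω) | 𝒢 k] =ᵐ[P] 0 :=
    fun j k => by
    have h1 := condExp_mul_of_stronglyMeasurable_left (hy j k) (hyv j k)
      ((he.noise_memLp j k).integrable one_le_two)
    have h2 := condExp_smul (μ := P) (2 * a k) (fun ω =>
      ⟪e j (k + 1) ω - a k • (v j k ω • φ j k ω), φ j k ω⟫ * v j k ω) (𝒢 k)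
    filter_upwards [h1, h2, he.condExp_noise j k] with ω h1 h2 h3
    refine h2.trans ?_
    rw [Pi.smul_apply]
    erw [h1]
    simp [h3]
  obtain ⟨⟨C, hC⟩, hlim⟩ := exists_integral_le_and_ae_tendsto (P := P) 𝒢'
    (V := fun k ω => ∑ j, ‖e j (k + k₀) ω‖ ^ 2)
    (d := fun k ω => ∑ j, 2 * a (k + k₀) * (⟪e j (k + k₀ + 1) ω
      - a (k + k₀) • (v j (k + k₀) ω • φ j (k + k₀) ω), φ j (k + k₀) ω⟫ * v j (k + k₀) ω))
    (q := fun k ω => ∑ j, a (k + k₀) ^ 2 * κ ^ 2 * v j (k + k₀) ω ^ 2)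
    (fun k ω => Finset.sum_nonneg fun j _ => sq_nonneg _)
    (fun k => Finset.stronglyMeasurable_fun_sum _ fun j _ => (hsm j _).norm.pow 2)
    (fun k => integrable_finsetSum _ fun j _ => hint j _)
    (fun k => integrable_finsetSum _ fun j _ => (hyv j _).const_mul _)
    (fun k => by
      have h1 := condExp_finsetSum (μ := P) (s := Finset.univ) (f := fun j ω =>
        2 * a (k + k₀) * (⟪e j (k + k₀ + 1) ω
          - a (k + k₀) • (v j (k + k₀) ω • φ j (k + k₀) ω), φ j (k + k₀) ω⟫ * v j (k + k₀) ω))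
        (fun j _ => (hyv j (k + k₀)).const_mul (2 * a (k + k₀))) (𝒢 (k + k₀))
      rw [Finset.sum_fn] at h1
      filter_upwards [h1, ae_all_iff.2 fun j => hd j (k + k₀)] with ω h1 h2
      refine h1.trans ?_
      rw [Finset.sum_apply]
      exact Finset.sum_eq_zero fun j _ => h2 j)
    (fun k ω => Finset.sum_nonneg fun j _ => by positivity)
    (fun k => Finset.stronglyMeasurable_fun_sum _ fun j _ => by
      have h1 : k + 1 + k₀ = k + k₀ + 1 := by ring
      change StronglyMeasurable[𝒢 (k + 1 + k₀)] _
      rw [h1]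
      exact ((((he.noise_past j (k + k₀)).mono (he.le _)).pow 2).const_mul _))
    (fun k => integrable_finsetSum _ fun j _ => (hvi j _).const_mul _)
    (by
      have h1 : Summable fun k => N * (a (k + k₀) ^ 2 * κ ^ 2 * β) :=
        ((((summable_nat_add_iff k₀).2 hsa).mul_right (κ ^ 2)).mul_right β).mul_left (N : ℝ)
      refine h1.of_nonneg_of_le (fun k => integral_nonneg fun ω =>
        Finset.sum_nonneg fun j _ => by positivity) fun k => ?_
      rw [integral_finsetSum _ fun j _ => (hvi j _).const_mul _]
      refine (Finset.sum_le_card_nsmul _ _ (a (k + k₀) ^ 2 * κ ^ 2 * β) fun j _ => ?_).trans_eq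
        (by simp)
      rw [integral_const_mul]
      exact mul_le_mul_of_nonneg_left (he.integral_noise_sq_le j _) (by positivity))
    (fun k ω => by
      have h1 : k + 1 + k₀ = k + k₀ + 1 := by ring
      simp only [h1]
      exact he.sum_norm_sq_step_le hA_symm hA_nonneg (ha_pos _) (hb_pos _)
        (hk₀ _ (Nat.le_add_left _ _)) ω)
  refine ⟨⟨C + ∑ k ∈ Finset.range k₀, ∑ j, ∫ ω, ‖e j k ω‖ ^ 2 ∂P, fun j k => ?_⟩, ?_⟩
  · have hnn : ∀ j k, 0 ≤ ∫ ω, ‖e j k ω‖ ^ 2 ∂P := fun j k => integral_nonneg fun ω => sq_nonneg _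
    have hj : ∀ k, ∫ ω, ‖e j k ω‖ ^ 2 ∂P ≤ ∑ j, ∫ ω, ‖e j k ω‖ ^ 2 ∂P := fun k =>
      Finset.single_le_sum (f := fun j => ∫ ω, ‖e j k ω‖ ^ 2 ∂P) (fun j _ => hnn j k)
        (Finset.mem_univ j)
    have hC' : ∀ k, ∑ j, ∫ ω, ‖e j (k + k₀) ω‖ ^ 2 ∂P ≤ C := fun k => by
      rw [← integral_finsetSum _ fun j _ => hint j _]
      exact hC k
    have hC0 : 0 ≤ C := (Finset.sum_nonneg fun j _ => hnn j _).trans (hC' 0)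
    rcases lt_or_ge k k₀ with hk | hk
    · have h1 := Finset.single_le_sum (f := fun k => ∑ j, ∫ ω, ‖e j k ω‖ ^ 2 ∂P)
        (fun k _ => Finset.sum_nonneg fun j _ => hnn j k) (Finset.mem_range.2 hk)
      linarith [hj k]
    · have h1 := hC' (k - k₀)
      rw [Nat.sub_add_cancel hk] at h1
      have h2 : 0 ≤ ∑ k ∈ Finset.range k₀, ∑ j, ∫ ω, ‖e j k ω‖ ^ 2 ∂P :=
        Finset.sum_nonneg fun k _ => Finset.sum_nonneg fun j _ => hnn j k
      linarith [hj k]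
  · filter_upwards [hlim] with ω hω
    exact hω.imp fun l hl => (tendsto_add_atTop_iff_nat k₀).1 hl

end IsNetworkErrorProcess

section L2

variable {Ω : Type*} {m0 : MeasurableSpace Ω} {P : Measure Ω} {H : Type*} [NormedAddCommGroup H]

lemma lintegral_nnnorm_sq_eq_ofReal {g : Ω → H} (hg : MemLp g 2 P) :
    ∫⁻ ω, (‖g ω‖₊ : ℝ≥0∞) ^ 2 ∂P = ENNReal.ofReal (∫ ω, ‖g ω‖ ^ 2 ∂P) := by
  rw [ofReal_integral_eq_lintegral_ofReal (hg.integrable_norm_pow (by norm_num))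
    (.of_forall fun ω => sq_nonneg _)]
  refine lintegral_congr fun ω => ?_
  rw [ENNReal.ofReal_pow (norm_nonneg _), ofReal_norm]
  rfl

lemma memLp_two_of_lintegral_nnnorm_sq_lt_top {g : Ω → H} (hg : AEStronglyMeasurable g P)
    (h : ∫⁻ ω, (‖g ω‖₊ : ℝ≥0∞) ^ 2 ∂P < ⊤) : MemLp g 2 P := by
  refine (memLp_two_iff_integrable_sq_norm hg).2 ⟨(hg.norm.pow 2), ?_⟩
  refine lt_of_eq_of_lt (lintegral_congr fun ω => ?_) h
  rw [enorm_pow, enorm_norm]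
  rfl

lemma toLp_finset_sum {ι : Type*} (s : Finset ι) {g : ι → Ω → H} (hg : ∀ i, MemLp (g i) 2 P)
    (hs : MemLp (fun ω => ∑ i ∈ s, g i ω) 2 P) :
    hs.toLp _ = ∑ i ∈ s, (hg i).toLp (g i) := by
  refine Lp.ext (hs.coeFn_toLp.trans ?_)
  have h1 : ∀ᵐ ω ∂P, ∀ i ∈ s, (hg i).toLp (g i) ω = g i ω :=
    (Finset.eventually_all s).2 fun i _ => (hg i).coeFn_toLp
  filter_upwards [Lp.coeFn_finsetSum s fun i => (hg i).toLp (g i), h1] with ω h2 h3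
  rw [h2]
  simp only [Finset.sum_apply]
  exact Finset.sum_congr rfl fun i hi => (h3 i hi).symm

variable [InnerProductSpace ℝ H]

lemma integral_norm_sq_eq_norm_toLp_sq {g : Ω → H} (hg : MemLp g 2 P) :
    ∫ ω, ‖g ω‖ ^ 2 ∂P = ‖hg.toLp g‖ ^ 2 := by
  rw [← real_inner_self_eq_norm_sq, L2.inner_def]
  refine integral_congr_ae (hg.coeFn_toLp.mono fun ω hω => ?_)
  simp only [hω, real_inner_self_eq_norm_sq]

lemma inner_toLp {g : Ω → H} (hg : MemLp g 2 P) (x : Lp H 2 P) :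
    ⟪x, hg.toLp g⟫ = ∫ ω, ⟪x ω, g ω⟫ ∂P := by
  rw [L2.inner_def]
  exact integral_congr_ae (hg.coeFn_toLp.mono fun ω hω => by simp only [hω])

lemma integral_inner_condExp [CompleteSpace H] {m : MeasurableSpace Ω} (hm : m ≤ m0)
    [SigmaFinite (P.trim hm)] {x z : Ω → H}
    (hx : AEStronglyMeasurable[m] x P) (hxz : Integrable (fun ω => ⟪x ω, z ω⟫) P)
    (hz : Integrable z P) : ∫ ω, ⟪x ω, (P[z | m]) ω⟫ ∂P = ∫ ω, ⟪x ω, z ω⟫ ∂P := by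
  have h1 := condExp_bilin_of_aestronglyMeasurable_left (innerSL ℝ) hx hxz hz
  exact (integral_congr_ae h1).symm.trans (integral_condExp hm)

lemma inner_compLpL_left (T : H →L[ℝ] H) (x y : Lp H 2 P) :
    ⟪T.compLpL 2 P x, y⟫ = ∫ ω, ⟪T (x ω), y ω⟫ ∂P := by
  rw [L2.inner_def]
  exact integral_congr_ae ((T.coeFn_compLpL x).mono fun ω hω => by simp only [hω])

lemma compLpL_isSymmetric {T : H →L[ℝ] H} (hT : ∀ x y, ⟪T x, y⟫ = ⟪x, T y⟫) :
    (T.compLpL 2 P : Lp H 2 P →ₗ[ℝ] Lp H 2 P).IsSymmetric := fun x y => by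
  rw [ContinuousLinearMap.coe_coe, inner_compLpL_left, real_inner_comm, inner_compLpL_left]
  exact integral_congr_ae (.of_forall fun ω => by simp only [hT, real_inner_comm (T (y ω))])

lemma inner_compLpL_self_nonneg {T : H →L[ℝ] H} (hT : ∀ x, 0 ≤ ⟪T x, x⟫) (x : Lp H 2 P) :
    0 ≤ ⟪T.compLpL 2 P x, x⟫ := by
  rw [inner_compLpL_left]
  exact integral_nonneg fun ω => hT _

lemma inner_compLpL_self_pos {T : H →L[ℝ] H} (hT : ∀ x, x ≠ 0 → 0 < ⟪T x, x⟫) {x : Lp H 2 P}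
    (hx : x ≠ 0) : 0 < ⟪T.compLpL 2 P x, x⟫ := by
  have hT0 : ∀ x, 0 ≤ ⟪T x, x⟫ := fun x => by
    rcases eq_or_ne x 0 with rfl | hx
    · simp
    · exact (hT x hx).le
  refine (inner_compLpL_self_nonneg hT0 x).lt_of_ne' fun h0 => hx ?_
  have hi : Integrable (fun ω => ⟪T (x ω), x ω⟫) P :=
    (L2.integrable_inner (𝕜 := ℝ) (T.compLpL 2 P x) x).congr
      ((T.coeFn_compLpL x).mono fun ω hω => by simp only [hω])
  rw [inner_compLpL_left, integral_eq_zero_iff_of_nonneg (fun ω => hT0 _) hi] at h0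
  refine (Lp.eq_zero_iff_ae_eq_zero).2 (h0.mono fun ω hω => ?_)
  by_contra hne
  exact (hT _ hne).ne' hω

end L2

namespace IsNetworkErrorProcess

variable {Ω : Type*} {m0 : MeasurableSpace Ω} {P : Measure Ω}
  {H : Type*} [NormedAddCommGroup H] [InnerProductSpace ℝ H] {N : ℕ} {A : Fin N → Fin N → ℝ}
  {a b : ℕ → ℝ} {𝓕 𝒢 : Filtration ℕ m0} {φ : Fin N → ℕ → Ω → H} {v : Fin N → ℕ → Ω → ℝ}
  {κ β : ℝ} {e : Fin N → ℕ → Ω → H}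

/-- The operator `x ↦ ⟪x, φ j k⟫ φ j k` on square integrable random elements. -/
def regressorOp (he : IsNetworkErrorProcess P A a b 𝓕 𝒢 φ v κ β e) (j : Fin N) (k : ℕ) :
    Lp H 2 P →ₗ[ℝ] Lp H 2 P where
  toFun x := (he.memLp_rankOne_apply (Lp.memLp x) j k).toLp _
  map_add' x y := by
    rw [← MemLp.toLp_add]
    exact MemLp.toLp_congr _ _ ((Lp.coeFn_add x y).mono fun ω hω => by
      simp only [hω, Pi.add_apply, map_add])
  map_smul' c x := by
    rw [RingHom.id_apply, ← MemLp.toLp_const_smul]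
    exact MemLp.toLp_congr _ _ ((Lp.coeFn_smul c x).mono fun ω hω => by
      simp only [hω, Pi.smul_apply, map_smul])

lemma coeFn_regressorOp (he : IsNetworkErrorProcess P A a b 𝓕 𝒢 φ v κ β e) (j : Fin N) (k : ℕ)
    (x : Lp H 2 P) :
    he.regressorOp j k x =ᵐ[P] fun ω => rankOne (φ j k ω) (φ j k ω) (x ω) :=
  (he.memLp_rankOne_apply (Lp.memLp x) j k).coeFn_toLp

lemma regressorOp_toLp (he : IsNetworkErrorProcess P A a b 𝓕 𝒢 φ v κ β e) (j : Fin N) (k : ℕ)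
    {g : Ω → H} (hg : MemLp g 2 P) :
    he.regressorOp j k (hg.toLp g) = (he.memLp_rankOne_apply hg j k).toLp _ :=
  MemLp.toLp_congr (he.memLp_rankOne_apply (Lp.memLp _) j k) _ (hg.coeFn_toLp.mono fun ω hω => by simp only [hω])

lemma norm_regressorOp_le (he : IsNetworkErrorProcess P A a b 𝓕 𝒢 φ v κ β e) (j : Fin N) (k : ℕ)
    (x : Lp H 2 P) : ‖he.regressorOp j k x‖ ≤ κ ^ 2 * ‖x‖ :=
  Lp.norm_le_mul_norm_of_ae_le_mul ((he.coeFn_regressorOp j k x).mono fun ω hω => by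
    rw [hω]
    exact norm_rankOne_self_apply_le (he.norm_le j k ω) _)

lemma regressorOp_mem_lpMeas (he : IsNetworkErrorProcess P A a b 𝓕 𝒢 φ v κ β e) (j : Fin N)
    (k : ℕ) {x : Lp H 2 P} (hx : x ∈ lpMeas H ℝ (𝓕 (k + 1)) 2 P) :
    he.regressorOp j k x ∈ lpMeas H ℝ (𝓕 (k + 1)) 2 P := by
  rw [mem_lpMeas_iff_aestronglyMeasurable] at hx ⊢
  have hφ := (he.regressor_past j k).aestronglyMeasurable (μ := P)
  refine AEStronglyMeasurable.congr ?_ (he.coeFn_regressorOp j k x).symm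
  simp only [rankOne_apply]
  exact (hx.inner hφ).smul hφ

lemma norm_toLp_noise_smul_le (he : IsNetworkErrorProcess P A a b 𝓕 𝒢 φ v κ β e) (j : Fin N)
    (k : ℕ) : ‖(he.memLp_noise_smul j k).toLp _‖ ≤ κ * √β := by
  have hκ := he.pos
  have hβ : 0 ≤ β := (integral_nonneg fun ω => sq_nonneg _).trans (he.integral_noise_sq_le j k)
  refine abs_le_of_sq_le_sq' ?_ (by positivity) |>.2
  rw [← integral_norm_sq_eq_norm_toLp_sq, mul_pow, Real.sq_sqrt hβ]
  refine (integral_mono ((he.memLp_noise_smul j k).integrable_norm_pow (by norm_num))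
    ((he.noise_memLp j k).integrable_sq.const_mul (κ ^ 2)) fun ω => ?_).trans ?_
  · simp only [norm_smul, mul_pow, Real.norm_eq_abs, sq_abs]
    rw [mul_comm]
    gcongr
    exact he.norm_le j k ω
  · rw [integral_const_mul]
    exact mul_le_mul_of_nonneg_left (he.integral_noise_sq_le j k) (sq_nonneg _)

variable [IsProbabilityMeasure P]

lemma toLp_step (he : IsNetworkErrorProcess P A a b 𝓕 𝒢 φ v κ β e) (j : Fin N) (k : ℕ) :
    (he.memLp j (k + 1)).toLp _ = (he.memLp j k).toLp _
      - a k • he.regressorOp j k ((he.memLp j k).toLp _)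
      + a k • (he.memLp_noise_smul j k).toLp _
      + b k • ∑ l, A j l • ((he.memLp l k).toLp _ - (he.memLp j k).toLp _) := by
  simp only [he.regressorOp_toLp, ← MemLp.toLp_sub, ← MemLp.toLp_const_smul, ← MemLp.toLp_add]
  have hs : ∀ l, MemLp (A j l • (e l k - e j k)) 2 P := fun l =>
    ((he.memLp l k).sub (he.memLp j k)).const_smul _
  rw [← toLp_finset_sum Finset.univ hs (memLp_finsetSum _ fun l _ => hs l),
    ← MemLp.toLp_const_smul, ← MemLp.toLp_add]
  exact MemLp.toLp_congr _ _ (.of_forall fun ω => he.step j k ω)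

variable [CompleteSpace H]

lemma inner_noise_eq_zero (he : IsNetworkErrorProcess P A a b 𝓕 𝒢 φ v κ β e) (j : Fin N) (k : ℕ)
    {x : Lp H 2 P} (hx : x ∈ lpMeas H ℝ (𝓕 k) 2 P) :
    ⟪x, (he.memLp_noise_smul j k).toLp _⟫ = 0 := by
  rw [mem_lpMeas_iff_aestronglyMeasurable] at hx
  have hint := (he.memLp_noise_smul j k).integrable one_le_two
  have hxw : Integrable (fun ω => ⟪x ω, v j k ω • φ j k ω⟫) P :=
    (L2.integrable_inner (𝕜 := ℝ) x ((he.memLp_noise_smul j k).toLp _)).congr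
      ((he.memLp_noise_smul j k).coeFn_toLp.mono fun ω hω => by simp only [hω])
  rw [inner_toLp, ← integral_inner_condExp (𝒢.le k) (hx.mono (he.le k)) hxw hint]
  have h1 := condExp_smul_of_aestronglyMeasurable_right
    ((he.noise_memLp j k).integrable one_le_two) hint
    (he.regressor j k).aestronglyMeasurable
  refine integral_eq_zero_of_ae ?_
  filter_upwards [h1, he.condExp_noise j k] with ω h1 h2
  rw [show (P[fun ω => v j k ω • φ j k ω | 𝒢 k]) ω = _ from h1]
  simp [h2]

lemma tendsto_and_ae_tendsto (he : IsNetworkErrorProcess P A a b 𝓕 𝒢 φ v κ β e)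
    (hA_symm : ∀ i j, A i j = A j i) (hA_nonneg : ∀ i j, 0 ≤ A i j)
    (hconn : ∀ i j : Fin N, Relation.ReflTransGen (fun p q : Fin N => 0 < A p q) i j)
    (ha_pos : ∀ k, 0 < a k) (hb_pos : ∀ k, 0 < b k) (ha : Antitone a) (hb : Antitone b)
    (hsa : Summable fun k => a k ^ 2) (hsb : Summable fun k => b k ^ 2) (hna : ¬ Summable a)
    {C : ℝ} (hC : 0 < C)
    (hab : ∀ k, max (a k - a (k + 1)) |b k - a k| ≤ C * (a k ^ 2 + b k ^ 2))
    {Nop : Fin N → H →L[ℝ] H} (hNs : ∀ j, ∀ x y : H, ⟪Nop j x, y⟫ = ⟪x, Nop j y⟫)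
    (hNp : ∀ j, ∀ x : H, 0 ≤ ⟪Nop j x, x⟫)
    (hNpos : ∀ x : H, x ≠ 0 → 0 < ⟪(∑ j, Nop j) x, x⟫) {h : ℕ} (hh : 0 < h)
    (hint : ∀ j i, Integrable (fun ω => rankOne (φ j i ω) (φ j i ω)) P)
    (hPE : ∀ g : ℕ → Ω → H, (∀ k, StronglyMeasurable[𝓕 (k * h)] (g k)) →
      (⨆ k, ∫⁻ ω, (‖g k ω‖₊ : ℝ≥0∞) ^ 2 ∂P) < ⊤ →
      (∑' (j : Fin N) (k : ℕ), ∫⁻ ω, (‖(Nop j - ∑ i ∈ Finset.Ico (k * h) ((k + 1) * h),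
        (P[fun ω' => rankOne (φ j i ω') (φ j i ω') | 𝓕 (k * h)]) ω) (g k ω)‖₊ : ℝ≥0∞) ^ 2 ∂P)
        < ⊤) :
    (∀ j, Tendsto (fun k => ∫⁻ ω, (‖e j k ω‖₊ : ℝ≥0∞) ^ 2 ∂P) atTop (nhds 0)) ∧
      ∀ j, ∀ᵐ ω ∂P, Tendsto (fun k => ‖e j k ω‖) atTop (nhds 0) := by
  obtain ⟨⟨D, hD⟩, hae⟩ :=
    he.exists_norm_bound_and_ae_tendsto hA_symm hA_nonneg ha_pos hb_pos hsa hsb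
  set E : Fin N → ℕ → Lp H 2 P := fun j k => (he.memLp j k).toLp (e j k) with hE
  have hED : ∀ j k, ‖E j k‖ ≤ √D := fun j k => by
    refine Real.le_sqrt_of_sq_le ?_
    rw [← integral_norm_sq_eq_norm_toLp_sq]
    exact hD j k
  set S : Fin N → ℕ → Ω → H →L[ℝ] H := fun j k ω => ∑ i ∈ Finset.Ico (k * h) ((k + 1) * h),
    (P[fun ω' => rankOne (φ j i ω') (φ j i ω') | 𝓕 (k * h)]) ω with hSdef
  have hSm : ∀ j k, StronglyMeasurable[𝓕 (k * h)] (S j k) := fun j k =>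
    Finset.stronglyMeasurable_fun_sum _ fun i _ => stronglyMeasurable_condExp
  have hdm : ∀ j k, StronglyMeasurable[𝓕 (k * h)] fun ω => (Nop j - S j k ω) (e j (k * h) ω) :=
    fun j k => (isBoundedBilinearMap_apply (𝕜 := ℝ)).continuous.comp_stronglyMeasurable
      ((stronglyMeasurable_const.sub (hSm j k)).prodMk (he.stronglyMeasurable j (k * h)))
  have hsum : ∀ j, ∑' k, ∫⁻ ω, (‖(Nop j - S j k ω) (e j (k * h) ω)‖₊ : ℝ≥0∞) ^ 2 ∂P < ⊤ :=
    fun j => by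
    refine (ENNReal.le_tsum j).trans_lt (hPE (fun k => e j (k * h))
      (fun k => he.stronglyMeasurable j (k * h)) ?_)
    refine (iSup_le fun k => ?_).trans_lt (ENNReal.ofReal_lt_top (r := D))
    rw [lintegral_nnnorm_sq_eq_ofReal (he.memLp j (k * h))]
    exact ENNReal.ofReal_le_ofReal (hD j _)
  have hdL : ∀ j k, MemLp (fun ω => (Nop j - S j k ω) (e j (k * h) ω)) 2 P := fun j k =>
    memLp_two_of_lintegral_nnnorm_sq_lt_top ((hdm j k).mono (𝓕.le _)).aestronglyMeasurable
      ((ENNReal.le_tsum k).trans_lt (hsum j))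
  set Y : Fin N → ℕ → Lp H 2 P := fun j k =>
    (Nop j).compLpL 2 P (E j (k * h)) - (hdL j k).toLp _ with hY
  have hYae : ∀ j k, Y j k =ᵐ[P] fun ω => S j k ω (e j (k * h) ω) := fun j k => by
    filter_upwards [Lp.coeFn_sub ((Nop j).compLpL 2 P (E j (k * h))) ((hdL j k).toLp _),
      (Nop j).coeFn_compLpL (E j (k * h)), (he.memLp j (k * h)).coeFn_toLp,
      (hdL j k).coeFn_toLp] with ω h1 h2 h3 h4
    rw [h1, Pi.sub_apply, h2, h4, h3, sub_apply, _root_.sub_sub_cancel]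
  have hEW : ∀ j k, E j k ∈ lpMeas H ℝ (𝓕 k) 2 P := fun j k => by
    rw [mem_lpMeas_iff_aestronglyMeasurable]
    exact (he.stronglyMeasurable j k).aestronglyMeasurable.congr (he.memLp j k).coeFn_toLp.symm
  have hNW : ∀ j k, ∀ x ∈ lpMeas H ℝ (𝓕 k) 2 P,
      (Nop j).compLpL 2 P x ∈ lpMeas H ℝ (𝓕 k) 2 P := fun j k x hx => by
    rw [mem_lpMeas_iff_aestronglyMeasurable] at hx ⊢
    exact ((Nop j).continuous.comp_aestronglyMeasurable hx).congr ((Nop j).coeFn_compLpL x).symm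
  have hlim : ∀ j, Tendsto (E j) atTop (nhds 0) := fun j =>
    tendsto_zero_of_network_recursion hA_symm hA_nonneg hconn ha_pos hb_pos ha hb hsa hsb hna hC
      hab (E := E) (w := fun j k => (he.memLp_noise_smul j k).toLp _) (H := he.regressorOp)
      (κ := κ ^ 2) (B := κ * √β) (D := √D) (sq_nonneg κ)
      (mul_nonneg he.pos.le (Real.sqrt_nonneg β)) (Real.sqrt_nonneg D)
      he.norm_regressorOp_le he.norm_toLp_noise_smul_le hED he.toLp_step
      (fun k => lpMeas H ℝ (𝓕 k) 2 P)
      (fun k l hkl x hx => by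
        rw [mem_lpMeas_iff_aestronglyMeasurable] at hx ⊢
        exact hx.mono (𝓕.mono hkl))
      (fun j k x hx => he.regressorOp_mem_lpMeas j k hx) hEW
      (fun j k => by
        rw [mem_lpMeas_iff_aestronglyMeasurable]
        exact ((he.noise_past j k).smul (he.regressor_past j k)).aestronglyMeasurable.congr
          (he.memLp_noise_smul j k).coeFn_toLp.symm)
      (fun j k x hx => he.inner_noise_eq_zero j k hx)
      (Nop := fun j => ((Nop j).compLpL 2 P : Lp H 2 P →ₗ[ℝ] Lp H 2 P))
      (fun j => compLpL_isSymmetric (hNs j)) (fun j => inner_compLpL_self_nonneg (hNp j))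
      (fun x hx => by
        have h1 := inner_compLpL_self_pos hNpos hx
        have h2 : (∑ j, Nop j).compLpL 2 P x = ∑ j, (Nop j).compLpL 2 P x := by
          refine Lp.ext ?_
          have h3 : ∀ᵐ ω ∂P, ∀ j, (Nop j).compLpL 2 P x ω = Nop j (x ω) :=
            ae_all_iff.2 fun j => (Nop j).coeFn_compLpL x
          filter_upwards [(∑ j, Nop j).coeFn_compLpL x, h3,
            Lp.coeFn_finsetSum Finset.univ fun j => (Nop j).compLpL 2 P x] with ω h4 h5 h6
          rw [h4, h6]
          simp only [sum_apply, Finset.sum_apply, h5]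
        rwa [h2, sum_inner] at h1)
      (cN := ∑ j, ‖Nop j‖ + 1) (by positivity)
      (fun j x => by
        refine (((Nop j).compLpL 2 P).le_opNorm x).trans
          (mul_le_mul_of_nonneg_right ?_ (norm_nonneg _))
        have h1 := Finset.single_le_sum (f := fun j => ‖Nop j‖) (fun _ _ => norm_nonneg _)
          (Finset.mem_univ j)
        have h2 := (Nop j).norm_compLpL_le (μ := P) (p := 2)
        linarith)
      hNW hh (Y := Y)
      (fun j k => by
        refine Submodule.sub_mem _ (hNW j _ _ (hEW j _)) ?_
        rw [mem_lpMeas_iff_aestronglyMeasurable]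
        exact (hdm j k).aestronglyMeasurable.congr (hdL j k).coeFn_toLp.symm)
      (fun j k x hx => by
        rw [mem_lpMeas_iff_aestronglyMeasurable] at hx
        have hZ : ∀ i, MemLp (fun ω => rankOne (φ j i ω) (φ j i ω) (e j (k * h) ω)) 2 P := fun i =>
          he.memLp_rankOne_apply (he.memLp j (k * h)) j i
        have hZs : MemLp (fun ω => ∑ i ∈ Finset.Ico (k * h) ((k + 1) * h),
          rankOne (φ j i ω) (φ j i ω) (e j (k * h) ω)) 2 P := memLp_finsetSum _ fun i _ => hZ i
        have hxZ : Integrable (fun ω => ⟪x ω, ∑ i ∈ Finset.Ico (k * h) ((k + 1) * h),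
            rankOne (φ j i ω) (φ j i ω) (e j (k * h) ω)⟫) P :=
          (L2.integrable_inner (𝕜 := ℝ) x (hZs.toLp _)).congr
            (hZs.coeFn_toLp.mono fun ω hω => by simp only [hω])
        have hcond : P[fun ω => ∑ i ∈ Finset.Ico (k * h) ((k + 1) * h),
            rankOne (φ j i ω) (φ j i ω) (e j (k * h) ω) | 𝓕 (k * h)]
            =ᵐ[P] fun ω => S j k ω (e j (k * h) ω) := by
          have h1 := condExp_bilin_of_stronglyMeasurable_right (μ := P)
            (ContinuousLinearMap.id ℝ (H →L[ℝ] H)) (he.stronglyMeasurable j (k * h))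
            (f := fun ω => ∑ i ∈ Finset.Ico (k * h) ((k + 1) * h), rankOne (φ j i ω) (φ j i ω))
            (by simpa only [ContinuousLinearMap.id_apply, sum_apply]
              using hZs.integrable one_le_two)
            (integrable_finsetSum _ fun i _ => hint j i)
          have h2 := condExp_finsetSum (μ := P) (s := Finset.Ico (k * h) ((k + 1) * h))
            (f := fun i ω => rankOne (φ j i ω) (φ j i ω)) (fun i _ => hint j i) (𝓕 (k * h))
          rw [Finset.sum_fn] at h2
          simp only [ContinuousLinearMap.id_apply, sum_apply] at h1
          filter_upwards [h1, h2] with ω h1 h2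
          rw [h1, h2, Finset.sum_apply]
        have hYx : ⟪x, Y j k⟫ = ∫ ω, ⟪x ω, ∑ i ∈ Finset.Ico (k * h) ((k + 1) * h),
            rankOne (φ j i ω) (φ j i ω) (e j (k * h) ω)⟫ ∂P := by
          rw [← integral_inner_condExp (𝓕.le (k * h)) hx hxZ (hZs.integrable one_le_two),
            L2.inner_def]
          refine integral_congr_ae ?_
          filter_upwards [hYae j k, hcond] with ω h1 h2
          rw [h1, h2]
        rw [inner_sub_right, hYx, sub_eq_zero]
        simp only [hE, he.regressorOp_toLp]
        rw [← toLp_finset_sum _ hZ hZs, inner_toLp])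
      (fun j => by
        have h1 : ∀ k, ‖(Nop j).compLpL 2 P (E j (k * h)) - Y j k‖ ^ 2
            = (∫⁻ ω, (‖(Nop j - S j k ω) (e j (k * h) ω)‖₊ : ℝ≥0∞) ^ 2 ∂P).toReal := fun k => by
          rw [lintegral_nnnorm_sq_eq_ofReal (hdL j k), ENNReal.toReal_ofReal
            (integral_nonneg fun ω => sq_nonneg _), integral_norm_sq_eq_norm_toLp_sq (hdL j k),
            _root_.sub_sub_cancel]
        exact (ENNReal.summable_toReal (hsum j).ne).congr fun k => (h1 k).symm) j
  have hsq : ∀ j, Tendsto (fun k => ∫ ω, ‖e j k ω‖ ^ 2 ∂P) atTop (nhds 0) := fun j => by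
    have h1 := (hlim j).norm.pow 2
    simp only [norm_zero, ne_eq, OfNat.ofNat_ne_zero, not_false_eq_true, zero_pow] at h1
    exact h1.congr fun k => (integral_norm_sq_eq_norm_toLp_sq (he.memLp j k)).symm
  have hms : ∀ j, Tendsto (fun k => ∫⁻ ω, (‖e j k ω‖₊ : ℝ≥0∞) ^ 2 ∂P) atTop (nhds 0) := fun j => by
    simp only [fun k => lintegral_nnnorm_sq_eq_ofReal (he.memLp j k)]
    simpa using ENNReal.tendsto_ofReal (hsq j)
  have hV : ∀ k, MemLp (fun ω => ∑ j, ‖e j k ω‖ ^ 2) 1 P := fun k =>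
    memLp_finsetSum _ fun j _ =>
      memLp_one_iff_integrable.2 ((he.memLp j k).integrable_norm_pow (by norm_num))
  have hVm : ∀ k, Measurable fun ω => ENNReal.ofReal (∑ j, ‖e j k ω‖ ^ 2) := fun k =>
    (Finset.stronglyMeasurable_fun_sum _ fun j _ => (((he.stronglyMeasurable j k).mono
      (𝓕.le k)).norm.pow 2)).measurable.ennreal_ofReal
  have hliminf : ∫⁻ ω, liminf (fun k => ENNReal.ofReal (∑ j, ‖e j k ω‖ ^ 2)) atTop ∂P = 0 := by
    refine le_antisymm ((lintegral_liminf_le hVm).trans_eq (Tendsto.liminf_eq ?_)) zero_le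
    have h1 : Tendsto (fun k => ENNReal.ofReal (∑ j, ∫ ω, ‖e j k ω‖ ^ 2 ∂P)) atTop (nhds 0) := by
      simpa using ENNReal.tendsto_ofReal (tendsto_finsetSum Finset.univ fun j _ => hsq j)
    refine h1.congr fun k => ?_
    rw [← ofReal_integral_eq_lintegral_ofReal (memLp_one_iff_integrable.1 (hV k))
      (.of_forall fun ω => Finset.sum_nonneg fun j _ => sq_nonneg _),
      integral_finsetSum _ fun j _ => (he.memLp j k).integrable_norm_pow (by norm_num)]
  rw [lintegral_eq_zero_iff (Measurable.liminf hVm)] at hliminf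
  refine ⟨hms, fun j => ?_⟩
  filter_upwards [hae, hliminf] with ω ⟨l, hl⟩ hω
  rw [(ENNReal.tendsto_ofReal hl).liminf_eq, Pi.zero_apply, ENNReal.ofReal_eq_zero] at hω
  have hl0 : l = 0 := le_antisymm hω
    (ge_of_tendsto' hl fun k => Finset.sum_nonneg fun j _ => sq_nonneg _)
  have h1 : Tendsto (fun k => ‖e j k ω‖ ^ 2) atTop (nhds 0) :=
    squeeze_zero (fun k => sq_nonneg _) (fun k => Finset.single_le_sum
      (f := fun j => ‖e j k ω‖ ^ 2) (fun j _ => sq_nonneg _) (Finset.mem_univ j)) (hl0 ▸ hl)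
  simpa [Real.sqrt_sq (norm_nonneg _)] using h1.sqrt

end IsNetworkErrorProcess

/-- The feature map of a continuous kernel is continuous. -/
lemma continuous_of_continuousOn_kernel {X HK : Type*} [TopologicalSpace X]
    [NormedAddCommGroup HK] [InnerProductSpace ℝ HK] {S : Set X} {K : X → X → ℝ}
    (hK : ContinuousOn (fun p : X × X => K p.1 p.2) (S ×ˢ S)) {Kx : S → HK}
    (hKer : ∀ x y : S, ⟪Kx x, Kx y⟫ = K x y) : Continuous Kx := by
  have hc : Continuous fun p : S × S => K p.1 p.2 :=
    hK.comp_continuous (continuous_subtype_val.prodMap continuous_subtype_val)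
      fun p => ⟨p.1.2, p.2.2⟩
  refine continuous_iff_continuousAt.2 fun x => tendsto_iff_norm_sub_tendsto_zero.2 ?_
  have h1 : Continuous fun y : S => K y y - 2 * K y x + K x x :=
    ((hc.comp (continuous_id.prodMk continuous_id)).sub
      (continuous_const.mul (hc.comp (continuous_id.prodMk continuous_const)))).add
      continuous_const
  have h2 : ∀ y : S, K y y - 2 * K y x + K x x = ‖Kx y - Kx x‖ ^ 2 := fun y => by
    rw [norm_sub_sq_real, ← real_inner_self_eq_norm_sq, ← real_inner_self_eq_norm_sq, hKer, hKer,
      hKer]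
  have h3 := (h1.tendsto x).sqrt
  simp only [h2, Real.sqrt_sq (norm_nonneg _), sub_self, norm_zero, Real.sqrt_sq le_rfl] at h3
  exact h3

lemma exists_pos_norm_le_of_kernel_le {X HK : Type*} [NormedAddCommGroup HK]
    [InnerProductSpace ℝ HK] {S : Set X} {K : X → X → ℝ} {Kx : S → HK}
    (hKer : ∀ x y : S, ⟪Kx x, Kx y⟫ = K x y) (hK : ∃ κ : ℝ, ∀ x : S, K x x ≤ κ) :
    ∃ κ > 0, ∀ x, ‖Kx x‖ ≤ κ := by
  obtain ⟨κ, hκ⟩ := hK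
  refine ⟨√κ + 1, by positivity, fun x => ?_⟩
  have h1 : ‖Kx x‖ ^ 2 ≤ κ := by
    rw [← real_inner_self_eq_norm_sq, hKer]
    exact hκ x
  linarith [Real.le_sqrt_of_sq_le h1]

section filtrations

variable {Ω X HK : Type*} {m0 : MeasurableSpace Ω} [NormedAddCommGroup HK] [InnerProductSpace ℝ HK]
  {N : ℕ} {Kx : X → HK} {xi : Fin N → ℕ → Ω → X} {v : Fin N → ℕ → Ω → ℝ}

lemma rkhsFilt_le {k : ℕ} {m : MeasurableSpace Ω}
    (hx : ∀ s < k, ∀ i g, Measurable[m] fun ω => ⟪g, Kx (xi i s ω)⟫)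
    (hv : ∀ s < k, ∀ i, Measurable[m] (v i s)) :
    @rkhsFilt Ω X HK m0 _ _ N Kx xi v k ≤ m :=
  iSup₂_le fun s hs => iSup_le fun i => sup_le
    (iSup_le fun g => (hx s (Finset.mem_range.1 hs) i g).comap_le)
    (hv s (Finset.mem_range.1 hs) i).comap_le

lemma measurable_rkhsFilt_inner {s k : ℕ} (hsk : s < k) (i : Fin N) (g : HK) :
    Measurable[rkhsFilt Kx xi v k] fun ω => ⟪g, Kx (xi i s ω)⟫ := by
  refine measurable_iff_comap_le.2 ?_
  refine le_trans ?_ (le_iSup₂_of_le s (Finset.mem_range.2 hsk)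
    (le_iSup_of_le i (le_sup_of_le_left (le_iSup_of_le g le_rfl))))
  exact le_rfl

lemma measurable_rkhsFilt_noise {s k : ℕ} (hsk : s < k) (i : Fin N) :
    Measurable[rkhsFilt Kx xi v k] (v i s) := by
  refine measurable_iff_comap_le.2 ?_
  refine le_trans ?_ (le_iSup₂_of_le s (Finset.mem_range.2 hsk)
    (le_iSup_of_le i (le_sup_of_le_right le_rfl)))
  exact le_rfl

/-- The filtration `k ↦ 𝓕(k−1)` generated by the past inputs and noises. -/
def pastFiltration (hx : ∀ i k g, Measurable fun ω => ⟪g, Kx (xi i k ω)⟫)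
    (hv : ∀ i k, Measurable (v i k)) : Filtration ℕ m0 where
  seq := rkhsFilt Kx xi v
  mono' _ _ hkl := rkhsFilt_le
    (fun _ hs i g => measurable_rkhsFilt_inner (hs.trans_le hkl) i g)
    (fun _ hs i => measurable_rkhsFilt_noise (hs.trans_le hkl) i)
  le' _ := rkhsFilt_le (fun s _ i g => hx i s g) fun s _ i => hv i s

/-- The σ-algebra generated by the noises before time `k`. -/
abbrev noisePast (v : Fin N → ℕ → Ω → ℝ) (k : ℕ) : MeasurableSpace Ω :=
  ⨆ s ∈ Finset.range k, ⨆ i, MeasurableSpace.comap (v i s) (borel ℝ)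

lemma noisePast_le {k : ℕ} {m : MeasurableSpace Ω} (hv : ∀ s < k, ∀ i, Measurable[m] (v i s)) :
    noisePast v k ≤ m :=
  iSup₂_le fun s hs => iSup_le fun i => (hv s (Finset.mem_range.1 hs) i).comap_le

lemma measurable_noisePast {s k : ℕ} (hsk : s < k) (i : Fin N) :
    Measurable[noisePast v k] (v i s) := by
  refine measurable_iff_comap_le.2 ?_
  refine le_trans ?_ (le_iSup₂_of_le s (Finset.mem_range.2 hsk) (le_iSup_of_le i le_rfl))
  exact le_rfl

lemma condExp_noisePast_eq_zero {P : Measure Ω} [IsFiniteMeasure P] {k : ℕ} {w : Ω → ℝ}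
    (hk : rkhsFilt Kx xi v k ≤ m0) (hw : P[w | rkhsFilt Kx xi v k] =ᵐ[P] 0) :
    P[w | noisePast v k] =ᵐ[P] 0 := by
  have hle : noisePast v k ≤ rkhsFilt Kx xi v k :=
    noisePast_le fun s hs i => measurable_rkhsFilt_noise hs i
  refine (condExp_condExp_of_le hle hk).symm.trans ?_
  exact (condExp_congr_ae hw).trans (by rw [condExp_zero])

/-- The filtration generated by all of `m` and the past noises. -/
def noiseFiltration (hv : ∀ i k, Measurable (v i k)) {m : MeasurableSpace Ω} (hm : m ≤ m0) :
    Filtration ℕ m0 where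
  seq k := m ⊔ noisePast v k
  mono' _ _ hkl := sup_le_sup_left
    (noisePast_le fun _ hs i => measurable_noisePast (hs.trans_le hkl) i) m
  le' _ := sup_le hm (noisePast_le fun s _ i => hv i s)

lemma pastFiltration_le_noiseFiltration (hx : ∀ i k g, Measurable fun ω => ⟪g, Kx (xi i k ω)⟫)
    (hv : ∀ i k, Measurable (v i k)) {m : MeasurableSpace Ω} (hm : m ≤ m0)
    (hxm : ∀ i k g, Measurable[m] fun ω => ⟪g, Kx (xi i k ω)⟫) (k : ℕ) :
    pastFiltration hx hv k ≤ noiseFiltration hv hm k :=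
  rkhsFilt_le (m0 := m0) (fun s _ i g => (hxm i s g).mono le_sup_left le_rfl)
    fun _ hs i => (measurable_noisePast hs i).mono le_sup_right le_rfl

end filtrations

/-- Theorem 3. For the decentralized online learning algorithm in the RKHS
`H_K`, suppose `𝒢` is connected, Assumptions A3–A5 and Conditions C1–C3 hold. If there exist
positive self-adjoint operators `N₁,…,N_N ∈ L(H_K)` with `∑ᵢ Nᵢ > 0` and an integer `h > 0`
satisfying the infinite-dimensional spatio-temporal persistence of excitation condition, then the
algorithm is both mean square consistent and almost surely strongly consistent. -/
theorem decentralized_online_learning.stmt6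
    {Ω : Type*} [MeasurableSpace Ω] (P : Measure Ω) [IsProbabilityMeasure P]
    -- the input space 𝒳 ⊆ ℝⁿ and the Mercer kernel K
    {n : ℕ} (S : Set (EuclideanSpace ℝ (Fin n))) (hS : S.Nonempty)
    (K : EuclideanSpace ℝ (Fin n) → EuclideanSpace ℝ (Fin n) → ℝ)
    (hK_cont : ContinuousOn
      (fun p : EuclideanSpace ℝ (Fin n) × EuclideanSpace ℝ (Fin n) => K p.1 p.2) (S ×ˢ S))
    (hK_symm : ∀ x ∈ S, ∀ y ∈ S, K x y = K y x)
    -- the reproducing kernel Hilbert space H_K with kernel sections K_x, x ∈ 𝒳;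
    -- the value of f ∈ H_K at x ∈ 𝒳 is f(x) = ⟪f, K_x⟫
    {HK : Type*} [NormedAddCommGroup HK] [InnerProductSpace ℝ HK] [CompleteSpace HK]
    (Kx : S → HK)
    (hKer : ∀ x y : S, ⟪Kx x, Kx y⟫ = K x y)
    -- the weighted adjacency matrix of the graph 𝒢
    {N : ℕ} (hN : 0 < N)
    (A : Fin N → Fin N → ℝ)
    (hA_symm : ∀ i j, A i j = A j i) (hA_nonneg : ∀ i j, 0 ≤ A i j) (hA_diag : ∀ i, A i i = 0)
    -- the graph 𝒢 is connected
    (hconn : ∀ i j : Fin N, Relation.ReflTransGen (fun p q : Fin N => 0 < A p q) i j)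
    -- random input data, noises and the unknown function f₀
    (xi : Fin N → ℕ → Ω → S)
    (hxi_meas : ∀ i k, Measurable (fun ω => (xi i k ω : EuclideanSpace ℝ (Fin n))))
    (v : Fin N → ℕ → Ω → ℝ)
    (hv_meas : ∀ i k, Measurable (v i k))
    (f₀ : HK)
    -- gains
    (a b : ℕ → ℝ) (ha_pos : ∀ k, 0 < a k) (hb_pos : ∀ k, 0 < b k)
    -- Assumption A3: the inputs are independent of the noises
    (hA3 : Indep
        (⨆ (i : Fin N) (k : ℕ), MeasurableSpace.comap
          (fun ω => (xi i k ω : EuclideanSpace ℝ (Fin n))) inferInstance)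
        (⨆ (i : Fin N) (k : ℕ), MeasurableSpace.comap (v i k) (borel ℝ)) P)
    -- Assumption A4: martingale difference noises with bounded conditional second moments
    (hA4_int : ∀ i k, Integrable (v i k) P)
    (hA4_mds : ∀ i k, P[v i k | rkhsFilt Kx xi v k] =ᵐ[P] 0)
    (hA4_int2 : ∀ i k, Integrable (fun ω => (v i k ω) ^ 2) P)
    (β : ℝ) (hβ : 0 < β)
    (hA4_bdd : ∀ i k, P[fun ω => (v i k ω) ^ 2 | rkhsFilt Kx xi v k] ≤ᵐ[P] fun _ => β)
    -- Assumption A5: bounded kernel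
    (hA5 : ∃ κ : ℝ, ∀ x : S, K x x ≤ κ)
    -- Conditions C1, C2, C3
    (hC1a : Antitone a) (hC1b : Antitone b)
    (hC2a : Summable (fun k => a k ^ 2)) (hC2b : Summable (fun k => b k ^ 2))
    (hC3a : ¬ Summable a)
    (hC3b : ∃ C > (0 : ℝ), ∀ k, max (a k - a (k + 1)) |b k - a k| ≤ C * (a k ^ 2 + b k ^ 2))
    -- the decentralized online learning algorithm with deterministic initial values
    (f : Fin N → ℕ → Ω → HK)
    (hf_init : ∀ i, ∃ c : HK, ∀ ω, f i 0 ω = c)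
    (hAlg : ∀ i k ω, f i (k + 1) ω = f i k ω
        + (a k * ((⟪f₀, Kx (xi i k ω)⟫ + v i k ω) - ⟪f i k ω, Kx (xi i k ω)⟫)) • Kx (xi i k ω)
        + b k • ∑ j, A i j • (f j k ω - f i k ω))
    -- positive self-adjoint operators Nⱼ with strictly positive sum
    (Nop : Fin N → HK →L[ℝ] HK)
    (hNop_sa : ∀ j, ∀ g₁ g₂ : HK, ⟪Nop j g₁, g₂⟫ = ⟪g₁, Nop j g₂⟫)
    (hNop_pos : ∀ j, ∀ g : HK, 0 ≤ ⟪Nop j g, g⟫)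
    (hNop_strict : ∀ g : HK, g ≠ 0 → 0 < ⟪(∑ j, Nop j) g, g⟫)
    (h : ℕ) (hh : 0 < h)
    (hKK_int : ∀ (j : Fin N) (i : ℕ),
        Integrable (fun ω => rankOne (Kx (xi j i ω)) (Kx (xi j i ω))) P)
    -- infinite-dimensional spatio-temporal persistence of excitation
    (hPE : ∀ g : ℕ → Ω → HK,
        (∀ k, StronglyMeasurable[rkhsFilt Kx xi v (k * h)] (g k)) →
        (⨆ k, ∫⁻ ω, (‖g k ω‖₊ : ℝ≥0∞) ^ 2 ∂P) < ⊤ →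
        (∑' (j : Fin N) (k : ℕ), ∫⁻ ω,
          (‖(Nop j - ∑ i ∈ Finset.Ico (k * h) ((k + 1) * h),
              (P[fun ω' => rankOne (Kx (xi j i ω')) (Kx (xi j i ω'))
                | rkhsFilt Kx xi v (k * h)]) ω) (g k ω)‖₊ : ℝ≥0∞) ^ 2 ∂P) < ⊤) :
    -- mean square and almost sure strong consistency
    (∀ i, Tendsto (fun k => ∫⁻ ω, (‖f i k ω - f₀‖₊ : ℝ≥0∞) ^ 2 ∂P) atTop (nhds 0)) ∧
      (∀ i, ∀ᵐ ω ∂P, Tendsto (fun k => ‖f i k ω - f₀‖) atTop (nhds 0)) := by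
  obtain ⟨κ, hκ0, hκ⟩ := exists_pos_norm_le_of_kernel_le hKer hA5
  obtain ⟨C, hC, hab⟩ := hC3b
  have hcont := continuous_of_continuousOn_kernel hK_cont hKer
  have hxF : ∀ i k (g : HK), Measurable[rkhsFilt Kx xi v (k + 1)] fun ω => ⟪g, Kx (xi i k ω)⟫ :=
    fun i k g => measurable_rkhsFilt_inner k.lt_succ_self i g
  have hvF : ∀ i k, Measurable[rkhsFilt Kx xi v (k + 1)] (v i k) := fun i k =>
    measurable_rkhsFilt_noise k.lt_succ_self i
  have hmX_le := iSup₂_le fun (i : Fin N) (k : ℕ) => (hxi_meas i k).comap_le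
  have hmV_le := iSup₂_le fun (i : Fin N) (k : ℕ) => (hv_meas i k).comap_le
  have hvV := fun (i : Fin N) (k : ℕ) => measurable_iff_comap_le.2
    (le_iSup₂ (f := fun (i : Fin N) k => MeasurableSpace.comap (v i k) (borel ℝ)) i k)
  have hxX := fun (i : Fin N) (k : ℕ) => measurable_iff_comap_le.2
    (le_iSup₂ (f := fun (i : Fin N) k => MeasurableSpace.comap
      (fun ω => (xi i k ω : EuclideanSpace ℝ (Fin n))) inferInstance) i k)
  set mX : MeasurableSpace Ω := ⨆ (i : Fin N) (k : ℕ), MeasurableSpace.comap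
    (fun ω => (xi i k ω : EuclideanSpace ℝ (Fin n))) inferInstance
  set mV : MeasurableSpace Ω := ⨆ (i : Fin N) (k : ℕ), MeasurableSpace.comap (v i k) (borel ℝ)
  have hφX : ∀ i k, StronglyMeasurable[mX] fun ω => Kx (xi i k ω) := fun i k =>
    hcont.stronglyMeasurable.comp_measurable (hxX i k).subtype_mk
  have hinX : ∀ i k (g : HK), Measurable[mX] fun ω => ⟪g, Kx (xi i k ω)⟫ := fun i k g =>
    ((continuous_const.inner continuous_id).comp_stronglyMeasurable (hφX i k)).measurable
  let 𝓕 := pastFiltration (fun i k g => (hinX i k g).mono hmX_le le_rfl) hv_meas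
  let 𝒢 := noiseFiltration hv_meas hmX_le
  have he : IsNetworkErrorProcess P A a b 𝓕 𝒢 (fun j k ω => Kx (xi j k ω)) v κ β
      (fun j k ω => f j k ω - f₀) :=
    { pos := hκ0
      norm_le := fun j k ω => hκ _
      le := pastFiltration_le_noiseFiltration _ hv_meas hmX_le hinX
      regressor_past := fun j k => stronglyMeasurable_of_measurable_inner
        (((TopologicalSpace.IsSeparable.of_separableSpace Set.univ).image hcont).mono
          (Set.range_subset_iff.2 fun ω => ⟨_, Set.mem_univ _, rfl⟩))
        (hxF j k)
      regressor := fun j k => (hφX j k).mono le_sup_left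
      noise_past := fun j k => (hvF j k).stronglyMeasurable
      noise_memLp := fun j k =>
        (memLp_two_iff_integrable_sq (hA4_int j k).aestronglyMeasurable).2 (hA4_int2 j k)
      integral_noise_sq_le := fun j k => by
        rw [← integral_condExp (𝓕.le k)]
        exact (integral_mono_ae integrable_condExp (integrable_const β) (hA4_bdd j k)).trans_eq
          (by simp)
      condExp_noise := fun j k => by
        refine condExp_sup_eq_zero_of_indep_s6 hmX_le hmV_le (noisePast_le fun s _ i => hvV i s) hA3
          (hvV j k).stronglyMeasurable (hA4_int j k) ?_
        exact condExp_noisePast_eq_zero (𝓕.le k) (hA4_mds j k)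
      init := fun j => (hf_init j).imp' (· - f₀) fun c hc ω => by simp only [hc ω]
      step := fun j k ω => by
        simp only [hAlg, rankOne_apply, inner_sub_left, sub_sub_sub_cancel_right]
        module }
  exact he.tendsto_and_ae_tendsto hA_symm hA_nonneg hconn ha_pos hb_pos hC1a hC1b hC2a hC2b hC3a
    hC hab hNop_sa hNop_pos hNop_strict hh hKK_int hPE
end
end
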